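/- arXiv:2408.15728 — 2 statements merged into one kernel-verified Lean document; each statement's English description precedes it below -/
import Mathlib

section
/- Let F be an infinite field, I, J, K finite sets, Λ ⊆ I × J × K nonempty, and let P be a probability distribution on I × J × K with support contained in Λ. Suppose (a,b,c) ∈ ℝ≥0³ satisfies a ≤ H(I)_P, b ≤ H(J)_P, c ≤ H(K)_P, a+b ≤ H(IJ)_P, a+c ≤ H(IK)_P, b+c ≤ H(JK)_P, and a+b+c ≤ H(IJK)_P. Then ω_s(a,b,c) ≤ log₂ Ř_s(Φ(Λ)) ≤ log₂ R_s(Φ(Λ)). -/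
open scoped BigOperators

/-- The rank of a tensor `t : I × J × K → F`. -/
noncomputable def TensorRank (F : Type*) [Field F] {I J K : Type*} (t : I × J × K → F) : ℕ :=
  sInf {L : ℕ | ∃ (a : Fin L → I → F) (b : Fin L → J → F) (c : Fin L → K → F),
    ∀ q : I × J × K, t q = ∑ m, a m q.1 * b m q.2.1 * c m q.2.2}

/-- The support rank of `Φ ⊆ I × J × K`. -/
noncomputable def SupportRank (F : Type*) [Field F] {I J K : Type*} (Φ : Set (I × J × K)) : ℕ :=
  sInf (TensorRank F '' {t : I × J × K → F | {q | t q ≠ 0} = Φ})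

/-- The `n`-fold product `Φ^{×n}` of a support `Φ ⊆ I × J × K`. -/
def PowSupport {I J K : Type*} (Φ : Set (I × J × K)) (n : ℕ) :
    Set ((Fin n → I) × (Fin n → J) × (Fin n → K)) :=
  {q | ∀ s : Fin n, (q.1 s, q.2.1 s, q.2.2 s) ∈ Φ}

/-- The asymptotic support rank `Ř_s(Φ) = inf_{n ≥ 1} R_s(Φ^{×n})^{1/n}`. -/
noncomputable def AsymptoticSupportRank (F : Type*) [Field F] {I J K : Type*}
    (Φ : Set (I × J × K)) : ℝ :=
  sInf {x : ℝ | ∃ n : ℕ, 0 < n ∧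
    x = (SupportRank F (PowSupport Φ n) : ℝ) ^ ((1 : ℝ) / n)}

/-- The support of the `l × m × n` matrix multiplication tensor. -/
def MMSupport (l m n : ℕ) :
    Set ((Fin l × Fin m) × (Fin m × Fin n) × (Fin n × Fin l)) :=
  {q | ∃ i j k, q = ((i, j), (j, k), (k, i))}

/-- The rectangular support rank exponent
`ω_s(a,b,c) = limsup_n (1/n) log₂ R_s(supp⟨⌊2^{an}⌋, ⌊2^{bn}⌋, ⌊2^{cn}⌋⟩)`. -/
noncomputable def omegaS (F : Type*) [Field F] (a b c : ℝ) : ℝ :=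
  Filter.limsup (fun n : ℕ =>
    (1 / n : ℝ) * Real.logb 2
      (SupportRank F (MMSupport ⌊(2 : ℝ) ^ (a * n)⌋₊ ⌊(2 : ℝ) ^ (b * n)⌋₊
        ⌊(2 : ℝ) ^ (c * n)⌋₊))) Filter.atTop

/-- The support of the partial matrix multiplication tensor with pattern `Λ`. -/
def PMMSupport {I J K : Type*} (Λ : Set (I × J × K)) :
    Set ((I × J) × (J × K) × (K × I)) :=
  {q | ∃ i j k, (i, j, k) ∈ Λ ∧ q = ((i, j), (j, k), (k, i))}

/-- `P` is a probability distribution on the finite set `X`. -/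
def IsProbDist {X : Type*} [Fintype X] (P : X → ℝ) : Prop :=
  (∀ x, 0 ≤ P x) ∧ ∑ x, P x = 1

/-- Shannon entropy (in bits) of a distribution on a finite set. -/
noncomputable def entropy {X : Type*} [Fintype X] (P : X → ℝ) : ℝ :=
  -∑ x, P x * Real.logb 2 (P x)

noncomputable def margI {I J K : Type*} [Fintype J] [Fintype K]
    (P : I × J × K → ℝ) : I → ℝ := fun i => ∑ j, ∑ k, P (i, j, k)

noncomputable def margJ {I J K : Type*} [Fintype I] [Fintype K]
    (P : I × J × K → ℝ) : J → ℝ := fun j => ∑ i, ∑ k, P (i, j, k)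

noncomputable def margK {I J K : Type*} [Fintype I] [Fintype J]
    (P : I × J × K → ℝ) : K → ℝ := fun k => ∑ i, ∑ j, P (i, j, k)

noncomputable def margIJ {I J K : Type*} [Fintype K]
    (P : I × J × K → ℝ) : I × J → ℝ := fun p => ∑ k, P (p.1, p.2, k)

noncomputable def margIK {I J K : Type*} [Fintype J]
    (P : I × J × K → ℝ) : I × K → ℝ := fun p => ∑ j, P (p.1, j, p.2)

noncomputable def margJK {I J K : Type*} [Fintype I]
    (P : I × J × K → ℝ) : J × K → ℝ := fun p => ∑ i, P (i, p.1, p.2)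

section SupportRank

variable {F : Type*} [Field F] {X Y Z : Type*}

/-- A decomposition of `t` into rank-one terms bounds the support rank of its support. -/
theorem supportRank_le_card {Φ : Set (X × Y × Z)} {ι : Type*} [Fintype ι] (t : X × Y × Z → F)
    (ht : {q | t q ≠ 0} = Φ) (a : ι → X → F) (b : ι → Y → F) (c : ι → Z → F)
    (h : ∀ q : X × Y × Z, t q = ∑ m, a m q.1 * b m q.2.1 * c m q.2.2) :
    SupportRank F Φ ≤ Fintype.card ι := by
  have hle : SupportRank F Φ ≤ TensorRank F t := Nat.sInf_le (Set.mem_image_of_mem _ ht)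
  refine hle.trans (Nat.sInf_le ?_)
  let e := (Fintype.equivFin ι).symm
  refine ⟨fun m => a (e m), fun m => b (e m), fun m => c (e m), fun q => ?_⟩
  rw [h q]
  exact (Equiv.sum_comp e fun m => a m q.1 * b m q.2.1 * c m q.2.2).symm

variable (F) in
/-- The support rank is attained by an explicit decomposition. -/
theorem exists_decomposition_supportRank [Finite X] [Finite Y] [Finite Z]
    (Φ : Set (X × Y × Z)) :
    ∃ (t : X × Y × Z → F) (a : Fin (SupportRank F Φ) → X → F)
      (b : Fin (SupportRank F Φ) → Y → F) (c : Fin (SupportRank F Φ) → Z → F),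
      {q | t q ≠ 0} = Φ ∧ ∀ q : X × Y × Z, t q = ∑ m, a m q.1 * b m q.2.1 * c m q.2.2 := by
  classical
  have := Fintype.ofFinite X
  have := Fintype.ofFinite Y
  have := Fintype.ofFinite Z
  have hne : (TensorRank F '' {t : X × Y × Z → F | {q | t q ≠ 0} = Φ}).Nonempty := by
    refine ⟨_, fun q => if q ∈ Φ then 1 else 0, ?_, rfl⟩
    ext q
    simp
  obtain ⟨t, ht, htr⟩ := Nat.sInf_mem hne
  have hr : {L : ℕ | ∃ (a : Fin L → X → F) (b : Fin L → Y → F) (c : Fin L → Z → F),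
      ∀ q : X × Y × Z, t q = ∑ m, a m q.1 * b m q.2.1 * c m q.2.2}.Nonempty := by
    let e := (Fintype.equivFin (X × Y × Z)).symm
    refine ⟨Fintype.card (X × Y × Z), fun m x => if x = (e m).1 then t (e m) else 0,
      fun m y => if y = (e m).2.1 then 1 else 0, fun m z => if z = (e m).2.2 then 1 else 0,
      fun q => ?_⟩
    have h1 := Equiv.sum_comp e fun p : X × Y × Z => (if q.1 = p.1 then t p else 0) *
      (if q.2.1 = p.2.1 then 1 else 0) * (if q.2.2 = p.2.2 then 1 else 0)
    refine Eq.trans ?_ h1.symm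
    rw [Finset.sum_eq_single q]
    · simp
    · intro p _ hp
      by_cases h1 : q.1 = p.1 <;> by_cases h2 : q.2.1 = p.2.1 <;>
        by_cases h3 : q.2.2 = p.2.2 <;> simp [h1, h2, h3]
      exact absurd (Prod.ext h1 (Prod.ext h2 h3)).symm hp
    · simp
  have hmem := Nat.sInf_mem hr
  change TensorRank F t ∈ _ at hmem
  rw [htr] at hmem
  obtain ⟨a, b, c, h⟩ := hmem
  exact ⟨t, a, b, c, ht, h⟩

variable (F) in
theorem supportRank_pos [Finite X] [Finite Y] [Finite Z] {Φ : Set (X × Y × Z)}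
    (hΦ : Φ.Nonempty) : 0 < SupportRank F Φ := by
  obtain ⟨t, a, b, c, ht, h⟩ := exists_decomposition_supportRank F Φ
  obtain ⟨q, hq⟩ := hΦ
  by_contra h0
  have : IsEmpty (Fin (SupportRank F Φ)) := by
    rw [Nat.eq_zero_of_not_pos h0]
    infer_instance
  rw [← ht] at hq
  exact hq (by rw [h q]; simp)

variable (F) in
/-- The support rank of a pullback is at most that of the original support. -/
theorem supportRank_preimage_le [Finite X] [Finite Y] [Finite Z] {X' Y' Z' : Type*}
    (Φ : Set (X × Y × Z)) (u : X' → X) (v : Y' → Y) (w : Z' → Z) :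
    SupportRank F {q : X' × Y' × Z' | (u q.1, v q.2.1, w q.2.2) ∈ Φ} ≤ SupportRank F Φ := by
  obtain ⟨t, a, b, c, ht, h⟩ := exists_decomposition_supportRank F Φ
  have := supportRank_le_card (F := F)
    (Φ := {q : X' × Y' × Z' | (u q.1, v q.2.1, w q.2.2) ∈ Φ})
    (fun q => t (u q.1, v q.2.1, w q.2.2)) (by rw [← ht]; rfl)
    (fun m x => a m (u x)) (fun m y => b m (v y)) (fun m z => c m (w z)) (fun q => h _)
  simpa using this

variable (F) in
theorem supportRank_powSupport_le [Finite X] [Finite Y] [Finite Z]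
    (Φ : Set (X × Y × Z)) (n : ℕ) :
    SupportRank F (PowSupport Φ n) ≤ SupportRank F Φ ^ n := by
  classical
  obtain ⟨t, a, b, c, ht, h⟩ := exists_decomposition_supportRank F Φ
  have := supportRank_le_card (F := F) (Φ := PowSupport Φ n)
    (ι := Fin n → Fin (SupportRank F Φ))
    (fun q => ∏ s, t (q.1 s, q.2.1 s, q.2.2 s))
    (by
      ext q
      simp only [Finset.prod_ne_zero_iff, Set.mem_ofPred_eq, PowSupport, ← ht, Finset.mem_univ,
        true_imp_iff])
    (fun m x => ∏ s, a (m s) (x s)) (fun m y => ∏ s, b (m s) (y s))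
    (fun m z => ∏ s, c (m s) (z s))
    (fun q => by simp only [h, Finset.prod_univ_sum, Fintype.piFinset_univ,
      Finset.prod_mul_distrib])
  simpa using this

variable (F) in
theorem supportRank_powSupport_mul_le [Finite X] [Finite Y] [Finite Z]
    (Φ : Set (X × Y × Z)) (q N : ℕ) :
    SupportRank F (PowSupport Φ (q * N)) ≤ SupportRank F (PowSupport Φ N) ^ q := by
  refine le_trans ?_ (supportRank_powSupport_le F (PowSupport Φ N) q)
  have := supportRank_preimage_le F (PowSupport (PowSupport Φ N) q)
    (X' := Fin (q * N) → X) (Y' := Fin (q * N) → Y) (Z' := Fin (q * N) → Z)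
    (fun x r s => x (finProdFinEquiv (r, s))) (fun x r s => x (finProdFinEquiv (r, s)))
    (fun x r s => x (finProdFinEquiv (r, s)))
  refine le_of_eq_of_le (congrArg _ (Set.ext fun p => ?_)) this
  simp only [PowSupport, Set.mem_ofPred_eq]
  rw [← finProdFinEquiv.forall_congr_right, Prod.forall]

/-- Over an infinite field, finitely many polynomials, each nonvanishing somewhere, have a common
point of nonvanishing. -/
theorem MvPolynomial.exists_forall_eval_ne_zero [Infinite F] {σ κ : Type*} [Finite κ]
    (p : κ → MvPolynomial σ F) (hp : ∀ i, ∃ x, MvPolynomial.eval x (p i) ≠ 0) :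
    ∃ x, ∀ i, MvPolynomial.eval x (p i) ≠ 0 := by
  have := Fintype.ofFinite κ
  by_contra! hcon
  have hz : ∏ i, p i = 0 := by
    refine MvPolynomial.funext fun x => ?_
    obtain ⟨i, hi⟩ := hcon x
    rw [map_prod, map_zero]
    exact Finset.prod_eq_zero (Finset.mem_univ i) hi
  obtain ⟨i, -, hi⟩ := Finset.prod_eq_zero_iff.mp hz
  obtain ⟨x, hx⟩ := hp i
  exact hx (by rw [hi, map_zero])

variable (F) in
/-- If `Ψ` is covered by the images of `Φ` under `s` triples of coordinate maps, all of which send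
`Φ` into `Ψ`, then `R_s(Ψ) ≤ s * R_s(Φ)`. -/
theorem supportRank_le_of_cover [Infinite F] [Finite X] [Finite Y] [Finite Z] {X' Y' Z' : Type*}
    [Finite X'] [Finite Y'] [Finite Z'] (Φ : Set (X × Y × Z)) (Ψ : Set (X' × Y' × Z')) (s : ℕ)
    (u : Fin s → X → X') (v : Fin s → Y → Y') (w : Fin s → Z → Z')
    (hmaps : ∀ r, ∀ q ∈ Φ, (u r q.1, v r q.2.1, w r q.2.2) ∈ Ψ)
    (hcover : ∀ q' ∈ Ψ, ∃ r, ∃ q ∈ Φ, (u r q.1, v r q.2.1, w r q.2.2) = q') :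
    SupportRank F Ψ ≤ s * SupportRank F Φ := by
  classical
  have := Fintype.ofFinite X
  have := Fintype.ofFinite Y
  have := Fintype.ofFinite Z
  obtain ⟨t, a, b, c, ht, h⟩ := exists_decomposition_supportRank F Φ
  let p : X' × Y' × Z' → MvPolynomial (Fin s × (X ⊕ Y ⊕ Z)) F := fun q' =>
    ∑ r, ∑ x, ∑ y, ∑ z, if (u r x, v r y, w r z) = q' then
      MvPolynomial.C (t (x, y, z)) * (MvPolynomial.X (r, Sum.inl x) *
        MvPolynomial.X (r, Sum.inr (Sum.inl y)) * MvPolynomial.X (r, Sum.inr (Sum.inr z))) else 0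
  have hp : ∀ q' : Ψ, ∃ ρ, MvPolynomial.eval ρ (p q') ≠ 0 := by
    rintro ⟨q', hq'⟩
    obtain ⟨r, ⟨x, y, z⟩, hq, hqq⟩ := hcover q' hq'
    refine ⟨fun i => if i = (r, Sum.inl x) ∨ i = (r, Sum.inr (Sum.inl y)) ∨
      i = (r, Sum.inr (Sum.inr z)) then 1 else 0, ?_⟩
    have hval : MvPolynomial.eval (fun i => if i = (r, Sum.inl x) ∨
        i = (r, Sum.inr (Sum.inl y)) ∨ i = (r, Sum.inr (Sum.inr z)) then (1 : F) else 0) (p q')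
        = t (x, y, z) := by
      simp only [p, map_sum]
      rw [Finset.sum_eq_single r, Finset.sum_eq_single x, Finset.sum_eq_single y,
        Finset.sum_eq_single z]
      · simp [hqq]
      all_goals first
        | (intro x' _ hx'; simp [apply_ite, hx'])
        | simp
    rw [hval]
    rw [← ht] at hq
    exact hq
  obtain ⟨ρ, hρ⟩ := MvPolynomial.exists_forall_eval_ne_zero (fun q' : Ψ => p q') hp
  have hcard := supportRank_le_card (F := F) (Φ := Ψ) (ι := Fin s × Fin (SupportRank F Φ))
    (fun q' => MvPolynomial.eval ρ (p q')) ?_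
    (fun m x' => ∑ x, if u m.1 x = x' then ρ (m.1, Sum.inl x) * a m.2 x else 0)
    (fun m y' => ∑ y, if v m.1 y = y' then ρ (m.1, Sum.inr (Sum.inl y)) * b m.2 y else 0)
    (fun m z' => ∑ z, if w m.1 z = z' then ρ (m.1, Sum.inr (Sum.inr z)) * c m.2 z else 0) ?_
  · simpa using hcard
  · ext q'
    refine ⟨fun hq' => ?_, fun hq' => hρ ⟨q', hq'⟩⟩
    by_contra hnot
    refine hq' ?_
    simp only [p, map_sum]
    refine Finset.sum_eq_zero fun r _ => Finset.sum_eq_zero fun x _ =>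
      Finset.sum_eq_zero fun y _ => Finset.sum_eq_zero fun z _ => ?_
    split_ifs with hc
    · have : t (x, y, z) = 0 := by
        by_contra htn
        have : (x, y, z) ∈ Φ := ht ▸ htn
        exact hnot (hc ▸ hmaps r _ this)
      simp [this]
    · simp
  · rintro ⟨x', y', z'⟩
    have hexpand (f : X → F) (g : Y → F) (k : Z → F) :
        (∑ x, f x) * (∑ y, g y) * (∑ z, k z) = ∑ x, ∑ y, ∑ z, f x * g y * k z := by
      rw [Finset.sum_mul_sum, Finset.sum_mul]
      refine Finset.sum_congr rfl fun x _ => ?_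
      rw [Finset.sum_mul]
      exact Finset.sum_congr rfl fun y _ => Finset.mul_sum _ _ _
    simp only [p, map_sum, Fintype.sum_prod_type, hexpand]
    refine Finset.sum_congr rfl fun r _ => ?_
    conv_rhs => rw [Finset.sum_comm]
    refine Finset.sum_congr rfl fun x _ => ?_
    conv_rhs => rw [Finset.sum_comm]
    refine Finset.sum_congr rfl fun y _ => ?_
    conv_rhs => rw [Finset.sum_comm]
    refine Finset.sum_congr rfl fun z _ => ?_
    by_cases hx : u r x = x' <;> by_cases hy : v r y = y' <;> by_cases hz : w r z = z' <;>
      simp [hx, hy, hz]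
    rw [h, Finset.sum_mul]
    exact Finset.sum_congr rfl fun m _ => by ring

end SupportRank
section Counting

/-- Second moment method: if the events `hit ω x` have density `1 / D` and the `Q`-weighted pair
correlations are bounded by `κ`, then a proportion at least `1 / (4 * κ)` of all `ω` hit some `x`
of positive weight. -/
theorem card_le_mul_card_hit {Ω X : Type*} [Fintype Ω] [Fintype X] (hit : Ω → X → Prop)
    [∀ ω x, Decidable (hit ω x)] (Q : X → ℝ) (D κ : ℝ) (ψ : X → X → ℝ)
    (hQ : ∀ x, 0 ≤ Q x) (hQ1 : ∑ x, Q x ≤ 1) (hQ2 : 1 / 2 ≤ ∑ x, Q x)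
    (hone : ∀ x, ((Finset.univ.filter fun ω => hit ω x).card : ℝ) * D = Fintype.card Ω)
    (htwo : ∀ x y, ((Finset.univ.filter fun ω => hit ω x ∧ hit ω y).card : ℝ) * D ^ 2 ≤
      Fintype.card Ω * ψ x y)
    (hκ : ∀ x, Q x ≠ 0 → ∑ y, Q y * ψ x y ≤ κ) (S : Finset Ω)
    (hS : ∀ ω x, Q x ≠ 0 → hit ω x → ω ∈ S) :
    (Fintype.card Ω : ℝ) ≤ 4 * κ * S.card := by
  classical
  let N : Ω → ℝ := fun ω => ∑ x, Q x * if hit ω x then 1 else 0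
  have hN1 : (∑ ω, N ω) * D = Fintype.card Ω * ∑ x, Q x := by
    simp only [N]
    rw [Finset.sum_comm, Finset.sum_mul, Finset.mul_sum]
    refine Finset.sum_congr rfl fun x _ => ?_
    rw [← Finset.mul_sum, Finset.sum_boole, mul_assoc, hone, mul_comm]
  have hN2 : (∑ ω, N ω ^ 2) * D ^ 2 ≤ Fintype.card Ω * κ := by
    have hsq : ∑ ω, N ω ^ 2 = ∑ x, ∑ y, Q x * Q y *
        ((Finset.univ.filter fun ω => hit ω x ∧ hit ω y).card : ℝ) := by
      simp only [N, sq, Finset.sum_mul_sum]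
      rw [Finset.sum_comm]
      refine Finset.sum_congr rfl fun x _ => ?_
      rw [Finset.sum_comm]
      refine Finset.sum_congr rfl fun y _ => ?_
      rw [← Finset.sum_boole, Finset.mul_sum]
      refine Finset.sum_congr rfl fun ω _ => ?_
      by_cases hx : hit ω x <;> by_cases hy : hit ω y <;> simp [hx, hy]
    have hle : ∀ x, ∑ y, Q x * Q y * ((Finset.univ.filter fun ω => hit ω x ∧ hit ω y).card : ℝ)
        * D ^ 2 ≤ Q x * (Fintype.card Ω * κ) := by
      intro x
      by_cases hx : Q x = 0
      · simp [hx]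
      calc _ ≤ ∑ y, Q x * (Fintype.card Ω * (Q y * ψ x y)) := by
            refine Finset.sum_le_sum fun y _ => ?_
            have := mul_le_mul_of_nonneg_left (htwo x y) (mul_nonneg (hQ x) (hQ y))
            linarith
        _ = Q x * (Fintype.card Ω * ∑ y, Q y * ψ x y) := by
            rw [Finset.mul_sum, Finset.mul_sum]
        _ ≤ _ := by
            gcongr
            · exact hQ x
            · exact hκ x hx
    have hκ0 : 0 ≤ (Fintype.card Ω : ℝ) * κ := by
      obtain ⟨x, hx⟩ : ∃ x, Q x ≠ 0 := by
        by_contra! h0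
        norm_num [h0] at hQ2
      have := hle x
      have h0 : 0 ≤ Q x * (Fintype.card Ω * κ) := le_trans (Finset.sum_nonneg fun y _ => by
        have := hQ x
        have := hQ y
        positivity) this
      exact nonneg_of_mul_nonneg_right h0 (lt_of_le_of_ne (hQ x) (Ne.symm hx))
    calc (∑ ω, N ω ^ 2) * D ^ 2 ≤ ∑ x, Q x * (Fintype.card Ω * κ) := by
          rw [hsq, Finset.sum_mul]
          refine Finset.sum_le_sum fun x _ => ?_
          rw [Finset.sum_mul]
          exact hle x
      _ = (∑ x, Q x) * (Fintype.card Ω * κ) := by rw [Finset.sum_mul]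
      _ ≤ _ := mul_le_of_le_one_left hκ0 hQ1
  have hCS : (∑ ω, N ω) ^ 2 ≤ S.card * ∑ ω, N ω ^ 2 := by
    have hres : ∑ ω, N ω = ∑ ω ∈ S, N ω := by
      refine (Finset.sum_subset (Finset.subset_univ S) fun ω _ hω => ?_).symm
      refine Finset.sum_eq_zero fun x _ => ?_
      by_cases hx : Q x = 0
      · simp [hx]
      · rw [if_neg fun h => hω (hS ω x hx h), mul_zero]
    rw [hres]
    refine sq_sum_le_card_mul_sum_sq.trans ?_
    gcongr
    exact Finset.subset_univ S
  rcases (Nat.cast_nonneg (α := ℝ) (Fintype.card Ω)).eq_or_lt with h0 | hpos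
  · have hΩ : IsEmpty Ω := Fintype.card_eq_zero_iff.mp (by exact_mod_cast h0.symm)
    simp [Finset.eq_empty_of_isEmpty S]
  have hlow : (Fintype.card Ω / 2 : ℝ) ^ 2 ≤ ((∑ ω, N ω) * D) ^ 2 := by
    rw [hN1]
    refine pow_le_pow_left₀ (by positivity) ?_ 2
    nlinarith
  have hup : ((∑ ω, N ω) * D) ^ 2 ≤ S.card * (Fintype.card Ω * κ) := by
    rw [mul_pow]
    calc _ ≤ (S.card * ∑ ω, N ω ^ 2) * D ^ 2 := by gcongr
      _ = S.card * ((∑ ω, N ω ^ 2) * D ^ 2) := by ring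
      _ ≤ _ := by gcongr
  have := hlow.trans hup
  refine le_of_mul_le_mul_left ?_ hpos
  nlinarith

theorem card_filter_forall_eq {A L : Type*} [Fintype A] [DecidableEq A] [Fintype L]
    [DecidableEq L] (T : Finset A) (τ : L) :
    (Finset.univ.filter fun f : A → L => ∀ x ∈ T, f x = τ).card * Fintype.card L ^ T.card =
      Fintype.card (A → L) := by
  have : (Finset.univ.filter fun f : A → L => ∀ x ∈ T, f x = τ) =
      Fintype.piFinset fun x => if x ∈ T then {τ} else Finset.univ := by
    ext f
    simp only [Finset.mem_filter, Finset.mem_univ, true_and, Fintype.mem_piFinset]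
    refine forall_congr' fun x => ?_
    split_ifs with hx <;> simp [hx]
  rw [this, Fintype.card_piFinset, Fintype.card_fun]
  simp only [apply_ite Finset.card, Finset.card_singleton, Finset.card_univ]
  rw [Finset.prod_ite, Finset.prod_const_one, Finset.prod_const, one_mul, ← pow_add]
  congr 1
  have h1 := Finset.card_filter_add_card_filter_not (s := (Finset.univ : Finset A)) (· ∈ T)
  rw [Finset.filter_univ_mem, Finset.card_univ] at h1
  omega

theorem card_filter_eq {A L : Type*} [Fintype A] [DecidableEq A] [Fintype L]
    [DecidableEq L] (x : A) (τ : L) :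
    ((Finset.univ.filter fun f : A → L => f x = τ).card : ℝ) * Fintype.card L =
      Fintype.card (A → L) := by
  have := card_filter_forall_eq {x} τ
  simp only [Finset.mem_singleton, forall_eq, Finset.card_singleton, pow_one] at this
  exact_mod_cast this

theorem card_filter_eq_and_eq_le {A L : Type*} [Fintype A] [DecidableEq A] [Fintype L]
    [DecidableEq L] (x y : A) (τ : L) :
    ((Finset.univ.filter fun f : A → L => f x = τ ∧ f y = τ).card : ℝ) * Fintype.card L ^ 2 ≤
      Fintype.card (A → L) * (1 + Fintype.card L * if x = y then 1 else 0) := by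
  by_cases hxy : x = y
  · subst hxy
    have := card_filter_eq x τ
    simp only [and_self, if_true]
    rw [← this]
    nlinarith [mul_nonneg (Nat.cast_nonneg (α := ℝ)
      (Finset.univ.filter fun f : A → L => f x = τ).card)
      (Nat.cast_nonneg (α := ℝ) (Fintype.card L))]
  · have := card_filter_forall_eq {x, y} τ
    simp only [Finset.mem_insert, Finset.mem_singleton, forall_eq_or_imp, forall_eq,
      Finset.card_pair hxy] at this
    simp only [hxy, if_false, mul_zero, add_zero, mul_one]
    exact_mod_cast this.le

/-- If every target is hit by a proportion at least `π` of all `ω`, then `s` suitably chosen `ω`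
hit all targets as soon as `|T| (1 - π) ^ s < 1`. -/
theorem exists_cover {Ω T : Type*} [Fintype Ω] [Nonempty Ω] [Fintype T] (S : T → Finset Ω)
    (π : ℝ) (hS : ∀ τ, π * Fintype.card Ω ≤ (S τ).card) (s : ℕ)
    (hs : Fintype.card T * (1 - π) ^ s < 1) : ∃ ω : Fin s → Ω, ∀ τ, ∃ r, ω r ∈ S τ := by
  classical
  by_contra! hcon
  have hcov : (Finset.univ : Finset (Fin s → Ω)) ⊆
      Finset.univ.biUnion fun τ : T => Fintype.piFinset fun _ : Fin s => (S τ)ᶜ := by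
    intro ω _
    obtain ⟨τ, hτ⟩ := hcon ω
    simpa using ⟨τ, hτ⟩
  have hcard := (Finset.card_le_card hcov).trans Finset.card_biUnion_le
  simp only [Finset.card_univ, Fintype.card_fun, Fintype.card_fin, Fintype.card_piFinset,
    Finset.prod_const] at hcard
  have hpos : (0 : ℝ) < Fintype.card Ω := by exact_mod_cast Fintype.card_pos
  have hb : ∀ τ, (((S τ)ᶜ.card ^ s : ℕ) : ℝ) ≤ (1 - π) ^ s * Fintype.card Ω ^ s := by
    intro τ
    rw [← mul_pow]
    push_cast
    refine pow_le_pow_left₀ (Nat.cast_nonneg _) ?_ s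
    rw [Finset.card_compl, Nat.cast_sub (Finset.card_le_univ _)]
    linarith [hS τ]
  have : (Fintype.card Ω : ℝ) ^ s ≤ Fintype.card T * (1 - π) ^ s * Fintype.card Ω ^ s := by
    calc (Fintype.card Ω : ℝ) ^ s ≤ ∑ τ : T, (((S τ)ᶜ.card ^ s : ℕ) : ℝ) := by exact_mod_cast hcard
      _ ≤ ∑ τ : T, (1 - π) ^ s * (Fintype.card Ω : ℝ) ^ s := Finset.sum_le_sum fun τ _ => hb τ
      _ = _ := by simp [mul_assoc]
  nlinarith [pow_pos hpos s]

end Counting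
section Entropy

variable {Y V : Type*} [Fintype Y]

/-- The `P`-mass of the fiber of `φ` through `x`. -/
noncomputable def fiberMass [DecidableEq V] (P : Y → ℝ) (φ : Y → V) (x : Y) : ℝ :=
  ∑ y, if φ y = φ x then P y else 0

/-- The entropy of the push-forward of `P` along `φ`, as an average over `P`. -/
noncomputable def fiberEntropy [DecidableEq V] (P : Y → ℝ) (φ : Y → V) : ℝ :=
  -∑ x, P x * Real.logb 2 (fiberMass P φ x)

theorem sum_pi_prod_eq_one {P : Y → ℝ} (hP : IsProbDist P) (M : ℕ) :
    ∑ x : Fin M → Y, ∏ s, P (x s) = 1 := by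
  classical
  have := Finset.prod_univ_sum (fun _ : Fin M => (Finset.univ : Finset Y)) fun _ y => P y
  rw [Fintype.piFinset_univ] at this
  rw [← this, hP.2, Finset.prod_const_one]

theorem sum_pi_succ {M : ℕ} (f : (Fin (M + 1) → Y) → ℝ) :
    ∑ x, f x = ∑ y : Y, ∑ x : Fin M → Y, f (Fin.cons y x) := by
  rw [← (Fin.consEquiv fun _ => Y).sum_comp, Fintype.sum_prod_type]
  rfl

theorem sum_pi_prod_mul_sum_eq_zero {P : Y → ℝ} (hP : IsProbDist P) {W : Y → ℝ}
    (hW : ∑ y, P y * W y = 0) (M : ℕ) :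
    ∑ x : Fin M → Y, (∏ s, P (x s)) * ∑ s, W (x s) = 0 := by
  induction M with
  | zero => simp
  | succ M ih =>
    rw [sum_pi_succ]
    simp only [Fin.prod_univ_succ, Fin.sum_univ_succ, Fin.cons_zero, Fin.cons_succ]
    calc _ = ∑ y, (P y * W y * ∑ x : Fin M → Y, ∏ s, P (x s) +
          P y * ∑ x : Fin M → Y, (∏ s, P (x s)) * ∑ s, W (x s)) := by
          refine Finset.sum_congr rfl fun y _ => ?_
          rw [Finset.mul_sum, Finset.mul_sum, ← Finset.sum_add_distrib]
          exact Finset.sum_congr rfl fun x _ => by ring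
      _ = 0 := by
          rw [ih, sum_pi_prod_eq_one hP]
          simpa using hW

/-- The variance of a sum of independent centered variables is additive. -/
theorem sum_pi_prod_mul_sum_sq {P : Y → ℝ} (hP : IsProbDist P) {W : Y → ℝ}
    (hW : ∑ y, P y * W y = 0) (M : ℕ) :
    ∑ x : Fin M → Y, (∏ s, P (x s)) * (∑ s, W (x s)) ^ 2 = M * ∑ y, P y * W y ^ 2 := by
  induction M with
  | zero => simp
  | succ M ih =>
    rw [sum_pi_succ]
    simp only [Fin.prod_univ_succ, Fin.sum_univ_succ, Fin.cons_zero, Fin.cons_succ]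
    calc _ = ∑ y, (P y * W y ^ 2 * ∑ x : Fin M → Y, ∏ s, P (x s) +
          2 * (P y * W y) * ∑ x : Fin M → Y, (∏ s, P (x s)) * ∑ s, W (x s) +
          P y * ∑ x : Fin M → Y, (∏ s, P (x s)) * (∑ s, W (x s)) ^ 2) := by
          refine Finset.sum_congr rfl fun y _ => ?_
          rw [Finset.mul_sum, Finset.mul_sum, Finset.mul_sum, ← Finset.sum_add_distrib,
            ← Finset.sum_add_distrib]
          exact Finset.sum_congr rfl fun x _ => by ring
      _ = _ := by
          rw [ih, sum_pi_prod_eq_one hP, sum_pi_prod_mul_sum_eq_zero hP hW]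
          simp only [mul_zero, add_zero, mul_one, Finset.sum_add_distrib]
          rw [← Finset.sum_mul, hP.2]
          push_cast
          ring

theorem fiberMass_pos [DecidableEq V] {P : Y → ℝ} (hP : IsProbDist P) (φ : Y → V) {x : Y}
    (hx : P x ≠ 0) : 0 < fiberMass P φ x := by
  have h : P x ≤ fiberMass P φ x := by
    have := Finset.single_le_sum (f := fun y => if φ y = φ x then P y else 0)
      (fun y _ => by split_ifs; exacts [hP.1 y, le_rfl]) (Finset.mem_univ x)
    simpa [fiberMass] using this
  exact lt_of_lt_of_le (lt_of_le_of_ne (hP.1 x) hx.symm) h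

/-- Asymptotic equipartition: with high probability, the fiber mass of a sequence of independent
samples is at most `2 ^ (-M (H - ε))`. -/
theorem eventually_sum_atypical_le [DecidableEq V] {P : Y → ℝ} (hP : IsProbDist P) (φ : Y → V)
    {ε δ : ℝ} (hε : 0 < ε) (hδ : 0 < δ) :
    ∀ᶠ M : ℕ in Filter.atTop, (∑ x : Fin M → Y, (∏ s, P (x s)) *
      if (2 : ℝ) ^ (-(M * (fiberEntropy P φ - ε))) < ∏ s, fiberMass P φ (x s) then 1 else 0)
        ≤ δ := by
  let W : Y → ℝ := fun y => Real.logb 2 (fiberMass P φ y) + fiberEntropy P φ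
  have hW : ∑ y, P y * W y = 0 := by
    simp only [W, mul_add, Finset.sum_add_distrib]
    rw [← Finset.sum_mul, hP.2, fiberEntropy]
    ring
  set v := ∑ y, P y * W y ^ 2 with hv
  filter_upwards [Filter.eventually_gt_atTop 0, Filter.eventually_ge_atTop ⌈v / (δ * ε ^ 2)⌉₊]
    with M hM0 hM
  have hM0' : (0 : ℝ) < M := by exact_mod_cast hM0
  have hMv : v / (δ * ε ^ 2) ≤ M := Nat.ceil_le.mp hM
  have hnn : ∀ x : Fin M → Y, 0 ≤ ∏ s, P (x s) := fun x => Finset.prod_nonneg fun s _ => hP.1 _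
  calc _ ≤ ∑ x : Fin M → Y, (∏ s, P (x s)) * ((∑ s, W (x s)) ^ 2 / (M * ε) ^ 2) := by
        refine Finset.sum_le_sum fun x _ => ?_
        by_cases hx : ∏ s, P (x s) = 0
        · simp [hx]
        refine mul_le_mul_of_nonneg_left ?_ (hnn x)
        split_ifs with hbad
        · have hpos : ∀ s, 0 < fiberMass P φ (x s) := fun s =>
            fiberMass_pos hP φ (Finset.prod_ne_zero_iff.mp hx s (Finset.mem_univ s))
          have hlog := Real.logb_lt_logb (b := 2) (by norm_num) (by positivity) hbad
          rw [Real.logb_rpow (by norm_num) (by norm_num),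
            Real.logb_prod _ _ fun s _ => (hpos s).ne'] at hlog
          have hsum : M * ε ≤ ∑ s, W (x s) := by
            simp only [W, Finset.sum_add_distrib, Finset.sum_const, Finset.card_univ,
              Fintype.card_fin, nsmul_eq_mul]
            linarith
          rw [le_div_iff₀ (by positivity), one_mul]
          exact pow_le_pow_left₀ (by positivity) hsum 2
        · positivity
    _ = M * v / (M * ε) ^ 2 := by
        simp only [← mul_div_assoc]
        rw [← Finset.sum_div, sum_pi_prod_mul_sum_sq hP hW]
    _ ≤ δ := by
        rw [div_le_iff₀ (by positivity)] at hMv ⊢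
        nlinarith

/-- The product measure of a fiber is the product of the fiber masses. -/
theorem sum_pi_prod_fiber [DecidableEq V] (P : Y → ℝ) (φ : Y → V) {M : ℕ} (x : Fin M → Y) :
    ∑ y : Fin M → Y, (∏ s, P (y s)) * (if ∀ s, φ (y s) = φ (x s) then 1 else 0) =
      ∏ s, fiberMass P φ (x s) := by
  classical
  simp only [fiberMass]
  rw [Finset.prod_univ_sum, Fintype.piFinset_univ]
  refine Finset.sum_congr rfl fun y _ => ?_
  rw [Finset.prod_ite_zero]
  simp

end Entropy
section Typical

theorem fiberEntropy_eq_entropy {Y V U : Type*} [Fintype Y] [DecidableEq V] [Fintype U]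
    [DecidableEq U] (P : Y → ℝ) (φ : Y → V) (ψ : Y → U) (h : ∀ x y, φ y = φ x ↔ ψ y = ψ x)
    (Q : U → ℝ) (hQ : ∀ u, Q u = ∑ y, if ψ y = u then P y else 0) :
    fiberEntropy P φ = entropy Q := by
  have hmass : ∀ x, fiberMass P φ x = Q (ψ x) := fun x => by simp only [fiberMass, h, hQ]
  have hQ' : ∀ u, Q u * Real.logb 2 (Q u) =
      ∑ y, if ψ y = u then P y * Real.logb 2 (Q u) else 0 := fun u => by
    conv_lhs => rw [hQ u, Finset.sum_mul, ← hQ u]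
    simp only [ite_mul, zero_mul]
  simp only [fiberEntropy, entropy, hmass, hQ']
  rw [Finset.sum_comm]
  simp

variable {I J K : Type*}

/-- The projection of `I × J × K` to the coordinates selected by `S`. -/
def mask (S : Bool × Bool × Bool) (q : I × J × K) : Option I × Option J × Option K :=
  (if S.1 then some q.1 else none, if S.2.1 then some q.2.1 else none,
    if S.2.2 then some q.2.2 else none)

theorem le_fiberEntropy_mask [Fintype I] [Fintype J] [Fintype K] [DecidableEq I] [DecidableEq J]
    [DecidableEq K] {P : I × J × K → ℝ} (hP : IsProbDist P) {a b c : ℝ}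
    (h1 : a ≤ entropy (margI P)) (h2 : b ≤ entropy (margJ P)) (h3 : c ≤ entropy (margK P))
    (h4 : a + b ≤ entropy (margIJ P)) (h5 : a + c ≤ entropy (margIK P))
    (h6 : b + c ≤ entropy (margJK P)) (h7 : a + b + c ≤ entropy P) (S : Bool × Bool × Bool) :
    (if S.1 then a else 0) + (if S.2.1 then b else 0) + (if S.2.2 then c else 0) ≤
      fiberEntropy P (mask S) := by
  obtain ⟨s1, s2, s3⟩ := S
  have hI := fun s : Bool × Bool × Bool => fiberEntropy_eq_entropy P (mask s) (fun q => q.1)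
  have hJ := fun s : Bool × Bool × Bool => fiberEntropy_eq_entropy P (mask s) (fun q => q.2.1)
  have hK := fun s : Bool × Bool × Bool => fiberEntropy_eq_entropy P (mask s) (fun q => q.2.2)
  have hIJ := fun s : Bool × Bool × Bool =>
    fiberEntropy_eq_entropy P (mask s) (fun q => (q.1, q.2.1))
  have hIK := fun s : Bool × Bool × Bool =>
    fiberEntropy_eq_entropy P (mask s) (fun q => (q.1, q.2.2))
  have hJK := fun s : Bool × Bool × Bool => fiberEntropy_eq_entropy P (mask s) (fun q => q.2)
  have hIJK := fun s : Bool × Bool × Bool => fiberEntropy_eq_entropy P (mask s) (fun q => q)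
  cases s1 <;> cases s2 <;> cases s3
  · simp [fiberEntropy, fiberMass, mask, hP.2]
  · rw [hK _ (by simp [mask]) (margK P) (fun u => by
      simp [margK, Fintype.sum_prod_type])]
    simpa using h3
  · rw [hJ _ (by simp [mask]) (margJ P) (fun u => by
      simp only [margJ, Fintype.sum_prod_type]
      refine Finset.sum_congr rfl fun i _ => ?_
      rw [Finset.sum_comm]
      simp)]
    simpa using h2
  · rw [hJK _ (by simp [mask, Prod.ext_iff]) (margJK P) (fun u => by
      rw [Fintype.sum_prod_type]
      simp [margJK])]
    simpa using h6
  · rw [hI _ (by simp [mask]) (margI P) (fun u => by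
      rw [Fintype.sum_prod_type, Finset.sum_comm]
      simp [margI, Fintype.sum_prod_type])]
    simpa using h1
  · rw [hIK _ (by simp [mask]) (margIK P) (fun u => by
      simp [margIK, Fintype.sum_prod_type, Prod.ext_iff, ite_and])]
    simpa using h5
  · rw [hIJ _ (by simp [mask]) (margIJ P) (fun u => by
      simp only [margIJ, Fintype.sum_prod_type, Prod.ext_iff, ite_and]
      simp only [Finset.sum_comm (s := (Finset.univ : Finset J))]
      rw [Finset.sum_comm]
      simp)]
    simpa using h4
  · rw [hIJK _ (by simp [mask, Prod.ext_iff]) P (fun u => by simp)]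
    simpa using h7

variable [Fintype I] [Fintype J] [Fintype K] [DecidableEq I] [DecidableEq J] [DecidableEq K]

/-- If typical sequences carry most of the mass, then every target is hit by a large proportion of
the triples of maps. -/
theorem card_le_mul_card_hit_of_typical {P : I × J × K → ℝ} (hP : IsProbDist P)
    {a b c ε : ℝ}
    (hent : ∀ S : Bool × Bool × Bool, (if S.1 then a else 0) + (if S.2.1 then b else 0) +
      (if S.2.2 then c else 0) ≤ fiberEntropy P (mask S)) (M : ℕ)
    (htyp : ∀ S : Bool × Bool × Bool, (∑ x : Fin M → I × J × K, (∏ s, P (x s)) *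
      if (2 : ℝ) ^ (-(M * (fiberEntropy P (mask S) - ε))) < ∏ s, fiberMass P (mask S) (x s)
        then 1 else 0) ≤ 1 / 16)
    {l m p : ℕ} (hl : (l : ℝ) ≤ 2 ^ (a * M)) (hm : (m : ℝ) ≤ 2 ^ (b * M))
    (hp : (p : ℝ) ≤ 2 ^ (c * M)) (τ : Fin l × Fin m × Fin p)
    (T : Finset (((Fin M → I) → Fin l) × ((Fin M → J) → Fin m) × ((Fin M → K) → Fin p)))
    (hT : ∀ ω (x : Fin M → I × J × K), (∀ s, P (x s) ≠ 0) → ω.1 (fun s => (x s).1) = τ.1 →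
      ω.2.1 (fun s => (x s).2.1) = τ.2.1 → ω.2.2 (fun s => (x s).2.2) = τ.2.2 → ω ∈ T) :
    (Fintype.card (((Fin M → I) → Fin l) × ((Fin M → J) → Fin m) × ((Fin M → K) → Fin p)) : ℝ) ≤
      32 * 2 ^ (ε * M) * T.card := by
  let bad : Bool × Bool × Bool → (Fin M → I × J × K) → Prop := fun S x =>
    (2 : ℝ) ^ (-(M * (fiberEntropy P (mask S) - ε))) < ∏ s, fiberMass P (mask S) (x s)
  have : ∀ S x, Decidable (bad S x) := fun S x => Classical.propDecidable _
  let R : (Fin M → I × J × K) → ℝ := fun x => ∏ s, P (x s)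
  let Q : (Fin M → I × J × K) → ℝ := fun x => R x * if ∀ S, ¬ bad S x then 1 else 0
  have hR : ∀ x, 0 ≤ R x := fun x => Finset.prod_nonneg fun s _ => hP.1 _
  have hQR : ∀ x, Q x ≤ R x := fun x => by
    refine mul_le_of_le_one_right (hR x) ?_
    split_ifs <;> norm_num
  have hQ : ∀ x, 0 ≤ Q x := fun x => mul_nonneg (hR x) (by split_ifs <;> norm_num)
  have hQ1 : ∑ x, Q x ≤ 1 :=
    (Finset.sum_le_sum fun x _ => hQR x).trans (sum_pi_prod_eq_one hP M).le
  have hQ2 : 1 / 2 ≤ ∑ x, Q x := by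
    have hpt : ∀ x, R x - ∑ S, R x * (if bad S x then 1 else 0) ≤ Q x := fun x => by
      by_cases hg : ∀ S, ¬ bad S x
      · simp [Q, hg]
      · push Not at hg
        obtain ⟨S, hS⟩ := hg
        have : R x ≤ ∑ S, R x * (if bad S x then 1 else 0) := by
          refine le_trans ?_ (Finset.single_le_sum
            (f := fun S => R x * (if bad S x then (1 : ℝ) else 0))
            (fun S _ => mul_nonneg (hR x) (by split_ifs <;> norm_num)) (Finset.mem_univ S))
          simp [hS]
        linarith [hQ x]
    have hsum := Finset.sum_le_sum fun x (_ : x ∈ Finset.univ) => hpt x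
    rw [Finset.sum_sub_distrib, Finset.sum_comm, sum_pi_prod_eq_one hP M] at hsum
    have hbad : ∑ S, ∑ x, R x * (if bad S x then 1 else 0) ≤
        ∑ _S : Bool × Bool × Bool, (1 / 16 : ℝ) :=
      Finset.sum_le_sum fun S _ => by
        refine le_of_eq_of_le ?_ (htyp S)
        congr! 3
    rw [Finset.sum_const, Finset.card_univ] at hbad
    have hnum : Fintype.card (Bool × Bool × Bool) • (1 / 16 : ℝ) = 1 / 2 := by norm_num
    linarith
  let wt : Bool × Bool × Bool → ℝ := fun S =>
    (if S.1 then (l : ℝ) else 1) * (if S.2.1 then (m : ℝ) else 1) * (if S.2.2 then (p : ℝ) else 1)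
  have hwt0 : ∀ S, 0 ≤ wt S := fun S => by
    simp only [wt]
    positivity
  have hwt : ∀ S, wt S * (2 : ℝ) ^ (-(M * (fiberEntropy P (mask S) - ε))) ≤ 2 ^ (ε * M) := by
    intro S
    have hle : wt S ≤ (2 : ℝ) ^ (((if S.1 then a else 0) + (if S.2.1 then b else 0) +
        (if S.2.2 then c else 0)) * M) := by
      rw [add_mul, add_mul, Real.rpow_add (by norm_num), Real.rpow_add (by norm_num)]
      simp only [wt]
      gcongr
      · split_ifs <;> simp [hl]
      · split_ifs <;> simp [hm]
      · split_ifs <;> simp [hp]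
    calc _ ≤ (2 : ℝ) ^ (((if S.1 then a else 0) + (if S.2.1 then b else 0) +
        (if S.2.2 then c else 0)) * M) * (2 : ℝ) ^ (-(M * (fiberEntropy P (mask S) - ε))) := by
          gcongr
      _ ≤ _ := by
          rw [← Real.rpow_add (by norm_num)]
          refine Real.rpow_le_rpow_of_exponent_le (by norm_num) ?_
          nlinarith [mul_le_mul_of_nonneg_right (hent S) (Nat.cast_nonneg (α := ℝ) M)]
  let ψ : (Fin M → I × J × K) → (Fin M → I × J × K) → ℝ := fun x y =>
    ∑ S, wt S * if ∀ s, mask S (y s) = mask S (x s) then 1 else 0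
  have hψ : ∀ x y, ψ x y =
      (1 + l * if (fun s => (x s).1) = (fun s => (y s).1) then 1 else 0) *
      (1 + m * if (fun s => (x s).2.1) = (fun s => (y s).2.1) then 1 else 0) *
      (1 + p * if (fun s => (x s).2.2) = (fun s => (y s).2.2) then 1 else 0) := by
    intro x y
    have e1 : (∀ s, (y s).1 = (x s).1) ↔ (fun s => (x s).1) = (fun s => (y s).1) := by
      rw [funext_iff]; exact forall_congr' fun s => eq_comm
    have e2 : (∀ s, (y s).2.1 = (x s).2.1) ↔ (fun s => (x s).2.1) = (fun s => (y s).2.1) := by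
      rw [funext_iff]; exact forall_congr' fun s => eq_comm
    have e3 : (∀ s, (y s).2.2 = (x s).2.2) ↔ (fun s => (x s).2.2) = (fun s => (y s).2.2) := by
      rw [funext_iff]; exact forall_congr' fun s => eq_comm
    simp only [ψ, wt, mask, Fintype.sum_prod_type, Fintype.sum_bool, Prod.mk.injEq, if_true,
      Bool.false_eq_true, if_false, Option.some.injEq, forall_and, e1, e2, e3, true_and,
      and_true, implies_true, mul_one, one_mul]
    by_cases q1 : (fun s => (x s).1) = (fun s => (y s).1) <;>
    by_cases q2 : (fun s => (x s).2.1) = (fun s => (y s).2.1) <;>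
    by_cases q3 : (fun s => (x s).2.2) = (fun s => (y s).2.2) <;>
    simp only [q1, q2, q3, if_true, if_false, and_self, and_true, and_false] <;>
    ring
  have key := card_le_mul_card_hit
    (Ω := ((Fin M → I) → Fin l) × ((Fin M → J) → Fin m) × ((Fin M → K) → Fin p))
    (fun ω x => ω.1 (fun s => (x s).1) = τ.1 ∧ ω.2.1 (fun s => (x s).2.1) = τ.2.1 ∧
      ω.2.2 (fun s => (x s).2.2) = τ.2.2) Q (l * (m * p)) (8 * 2 ^ (ε * M)) ψ hQ hQ1 hQ2
    ?_ ?_ ?_ T ?_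
  · linarith
  · intro x
    have h1 := card_filter_eq (fun s => (x s).1) τ.1
    have h2 := card_filter_eq (fun s => (x s).2.1) τ.2.1
    have h3 := card_filter_eq (fun s => (x s).2.2) τ.2.2
    simp only [Fintype.card_fin] at h1 h2 h3
    rw [Fintype.card_prod, Fintype.card_prod, Nat.cast_mul, Nat.cast_mul, ← h1, ← h2, ← h3,
      ← Finset.univ_product_univ, ← Finset.univ_product_univ,
      Finset.filter_product (fun f : (Fin M → I) → Fin l => f (fun s => (x s).1) = τ.1)
        (fun g : ((Fin M → J) → Fin m) × ((Fin M → K) → Fin p) =>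
          g.1 (fun s => (x s).2.1) = τ.2.1 ∧ g.2 (fun s => (x s).2.2) = τ.2.2),
      Finset.filter_product (fun f : (Fin M → J) → Fin m => f (fun s => (x s).2.1) = τ.2.1)
        (fun g : (Fin M → K) → Fin p => g (fun s => (x s).2.2) = τ.2.2),
      Finset.card_product, Finset.card_product]
    push_cast
    ring
  · intro x y
    have h1 := card_filter_eq_and_eq_le (fun s => (x s).1) (fun s => (y s).1) τ.1
    have h2 := card_filter_eq_and_eq_le (fun s => (x s).2.1) (fun s => (y s).2.1) τ.2.1
    have h3 := card_filter_eq_and_eq_le (fun s => (x s).2.2) (fun s => (y s).2.2) τ.2.2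
    simp only [Fintype.card_fin] at h1 h2 h3
    have hcard : ((Finset.univ : Finset (((Fin M → I) → Fin l) × ((Fin M → J) → Fin m) ×
        ((Fin M → K) → Fin p))).filter fun ω =>
        (ω.1 (fun s => (x s).1) = τ.1 ∧ ω.2.1 (fun s => (x s).2.1) = τ.2.1 ∧
          ω.2.2 (fun s => (x s).2.2) = τ.2.2) ∧
        (ω.1 (fun s => (y s).1) = τ.1 ∧ ω.2.1 (fun s => (y s).2.1) = τ.2.1 ∧
          ω.2.2 (fun s => (y s).2.2) = τ.2.2)) =
        (Finset.univ.filter fun f : (Fin M → I) → Fin l =>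
          f (fun s => (x s).1) = τ.1 ∧ f (fun s => (y s).1) = τ.1) ×ˢ
        (Finset.univ.filter fun f : (Fin M → J) → Fin m =>
          f (fun s => (x s).2.1) = τ.2.1 ∧ f (fun s => (y s).2.1) = τ.2.1) ×ˢ
        (Finset.univ.filter fun f : (Fin M → K) → Fin p =>
          f (fun s => (x s).2.2) = τ.2.2 ∧ f (fun s => (y s).2.2) = τ.2.2) := by
      ext ω
      simp only [Finset.mem_filter, Finset.mem_univ, true_and, Finset.mem_product]
      tauto
    rw [hcard, Finset.card_product, Finset.card_product, Fintype.card_prod, Fintype.card_prod, hψ]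
    have h12 := mul_le_mul h1 (mul_le_mul h2 h3 (by positivity) (by positivity)) (by positivity)
      (by positivity)
    push_cast
    refine le_trans (le_of_eq ?_) (h12.trans (le_of_eq ?_)) <;> ring
  · intro x hx
    have hgood : ∀ S, ∏ s, fiberMass P (mask S) (x s) ≤
        (2 : ℝ) ^ (-(M * (fiberEntropy P (mask S) - ε))) := by
      intro S
      by_contra hS
      exact hx (by
        simp only [Q]
        rw [if_neg fun h => h S (not_le.mp hS), mul_zero])
    calc ∑ y, Q y * ψ x y
        = ∑ S, wt S * ∑ y, Q y * (if ∀ s, mask S (y s) = mask S (x s) then 1 else 0) := by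
          simp only [ψ, Finset.mul_sum]
          rw [Finset.sum_comm]
          refine Finset.sum_congr rfl fun S _ => Finset.sum_congr rfl fun y _ => by ring
      _ ≤ ∑ _S : Bool × Bool × Bool, (2 : ℝ) ^ (ε * M) := by
          refine Finset.sum_le_sum fun S _ => le_trans ?_ (hwt S)
          refine mul_le_mul_of_nonneg_left (le_trans ?_ (hgood S)) (hwt0 S)
          rw [← sum_pi_prod_fiber]
          refine Finset.sum_le_sum fun y _ => ?_
          exact mul_le_mul_of_nonneg_right (hQR y) (by split_ifs <;> norm_num)
      _ = _ := by simp
  · rintro ω x hx ⟨q1, q2, q3⟩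
    refine hT ω x (fun s hs => hx ?_) q1 q2 q3
    simp only [Q, R]
    rw [Finset.prod_eq_zero (Finset.mem_univ s) hs, zero_mul]

end Typical
section MatrixMultiplication

theorem PMMSupport.nonempty {I J K : Type*} {Λ : Set (I × J × K)} (hΛ : Λ.Nonempty) :
    (PMMSupport Λ).Nonempty := by
  obtain ⟨⟨i, j, k⟩, h⟩ := hΛ
  exact ⟨_, i, j, k, h, rfl⟩

theorem PowSupport.nonempty {X Y Z : Type*} {Φ : Set (X × Y × Z)} (hΦ : Φ.Nonempty) (n : ℕ) :
    (PowSupport Φ n).Nonempty := by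
  obtain ⟨q, h⟩ := hΦ
  exact ⟨(fun _ => q.1, fun _ => q.2.1, fun _ => q.2.2), fun _ => h⟩

/-- If `s` triples of maps send the pattern `Λ ^ M` onto `[l] × [m] × [p]`, then the matrix
multiplication support is covered by `s` copies of the partial one. -/
theorem supportRank_MMSupport_le_of_cover (F : Type*) [Field F] [Infinite F] {I J K : Type*}
    [Finite I] [Finite J] [Finite K] (Λ : Set (I × J × K)) {M l m p s : ℕ}
    (ω : Fin s → ((Fin M → I) → Fin l) × ((Fin M → J) → Fin m) × ((Fin M → K) → Fin p))
    (hω : ∀ τ : Fin l × Fin m × Fin p, ∃ r, ∃ x : Fin M → I × J × K, (∀ t, x t ∈ Λ) ∧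
      (ω r).1 (fun t => (x t).1) = τ.1 ∧ (ω r).2.1 (fun t => (x t).2.1) = τ.2.1 ∧
      (ω r).2.2 (fun t => (x t).2.2) = τ.2.2) :
    SupportRank F (MMSupport l m p) ≤ s * SupportRank F (PowSupport (PMMSupport Λ) M) := by
  refine supportRank_le_of_cover F (PowSupport (PMMSupport Λ) M) (MMSupport l m p) s
    (fun r x => ((ω r).1 fun t => (x t).1, (ω r).2.1 fun t => (x t).2))
    (fun r y => ((ω r).2.1 fun t => (y t).1, (ω r).2.2 fun t => (y t).2))
    (fun r z => ((ω r).2.2 fun t => (z t).1, (ω r).1 fun t => (z t).2)) ?_ ?_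
  · rintro r ⟨x, y, z⟩ hq
    choose i j k _ h using hq
    simp only [Prod.mk.injEq] at h
    refine ⟨(ω r).1 i, (ω r).2.1 j, (ω r).2.2 k, ?_⟩
    simp only [h]
  · rintro q' ⟨i, j, k, rfl⟩
    obtain ⟨r, x, hx, h1, h2, h3⟩ := hω (i, j, k)
    refine ⟨r, (fun t => ((x t).1, (x t).2.1), fun t => ((x t).2.1, (x t).2.2),
      fun t => ((x t).2.2, (x t).1)), fun t => ⟨_, _, _, hx t, rfl⟩, ?_⟩
    simp only at h1 h2 h3
    simp only [h1, h2, h3]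

theorem eventually_mul_add_le_rpow (d : ℝ) {ε : ℝ} (hε : 0 < ε) :
    ∀ᶠ M : ℕ in Filter.atTop, 32 * (d * M + 1) + 1 ≤ (2 : ℝ) ^ (ε * M) := by
  have hb : 0 < ε * Real.log 2 := mul_pos hε (Real.log_pos (by norm_num))
  have h1 := (isLittleO_pow_exp_pos_mul_atTop 1 hb).bound
    (show (0 : ℝ) < 1 / (32 * |d| + 33) by positivity)
  have h2 := tendsto_natCast_atTop_atTop (R := ℝ) |>.eventually h1
  filter_upwards [h2, Filter.eventually_ge_atTop 1] with M hM hM1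
  have hM1' : (1 : ℝ) ≤ M := by exact_mod_cast hM1
  rw [pow_one, Real.norm_of_nonneg (by positivity), Real.norm_of_nonneg (by positivity),
    one_div, ← div_eq_inv_mul, le_div_iff₀ (by positivity)] at hM
  rw [Real.rpow_def_of_pos (by norm_num)]
  have he : Real.log 2 * (ε * M) = ε * Real.log 2 * M := by ring
  rw [he]
  refine le_trans ?_ hM
  nlinarith [le_abs_self d]

/-- Matrix multiplication of size within the entropy bounds reduces, up to subexponentially many
copies, to powers of the partial matrix multiplication support. -/
theorem eventually_supportRank_MMSupport_le (F : Type*) [Field F] [Infinite F]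
    {I J K : Type*} [Fintype I] [Fintype J] [Fintype K] (Λ : Set (I × J × K))
    (P : I × J × K → ℝ) (hP : IsProbDist P) (hsupp : ∀ q : I × J × K, P q ≠ 0 → q ∈ Λ)
    (a b c : ℝ) (ha : 0 ≤ a) (hb : 0 ≤ b) (hc : 0 ≤ c)
    (h1 : a ≤ entropy (margI P)) (h2 : b ≤ entropy (margJ P)) (h3 : c ≤ entropy (margK P))
    (h4 : a + b ≤ entropy (margIJ P)) (h5 : a + c ≤ entropy (margIK P))
    (h6 : b + c ≤ entropy (margJK P)) (h7 : a + b + c ≤ entropy P) {ε : ℝ} (hε : 0 < ε) :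
    ∀ᶠ M : ℕ in Filter.atTop, ∀ l m p : ℕ, 0 < l → 0 < m → 0 < p →
      (l : ℝ) ≤ 2 ^ (a * M) → (m : ℝ) ≤ 2 ^ (b * M) → (p : ℝ) ≤ 2 ^ (c * M) →
      (SupportRank F (MMSupport l m p) : ℝ) ≤
        2 ^ (2 * ε * M) * SupportRank F (PowSupport (PMMSupport Λ) M) := by
  classical
  have hent := le_fiberEntropy_mask hP h1 h2 h3 h4 h5 h6 h7
  filter_upwards [Filter.eventually_all.mpr fun S : Bool × Bool × Bool =>
    eventually_sum_atypical_le hP (mask S) hε (show (0 : ℝ) < 1 / 16 by norm_num),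
    eventually_mul_add_le_rpow (a + b + c) hε] with M htyp hM l m p hl0 hm0 hp0 hl hm hp
  have : Nonempty (Fin l) := ⟨⟨0, hl0⟩⟩
  have : Nonempty (Fin m) := ⟨⟨0, hm0⟩⟩
  have : Nonempty (Fin p) := ⟨⟨0, hp0⟩⟩
  let hits : Fin l × Fin m × Fin p →
      Finset (((Fin M → I) → Fin l) × ((Fin M → J) → Fin m) × ((Fin M → K) → Fin p)) := fun τ =>
    Finset.univ.filter fun ω => ∃ x : Fin M → I × J × K, (∀ t, x t ∈ Λ) ∧
      ω.1 (fun t => (x t).1) = τ.1 ∧ ω.2.1 (fun t => (x t).2.1) = τ.2.1 ∧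
      ω.2.2 (fun t => (x t).2.2) = τ.2.2
  set G : ℝ := 32 * 2 ^ (ε * M) with hG
  have hG1 : 1 ≤ G := by
    have : (1 : ℝ) ≤ 2 ^ (ε * M) := Real.one_le_rpow (by norm_num) (by positivity)
    linarith
  have hG0 : 0 < G := by linarith
  have hhits : ∀ τ, 1 / G * Fintype.card
      (((Fin M → I) → Fin l) × ((Fin M → J) → Fin m) × ((Fin M → K) → Fin p)) ≤
      (hits τ).card := by
    intro τ
    rw [one_div, ← div_eq_inv_mul, div_le_iff₀ hG0, mul_comm]
    refine card_le_mul_card_hit_of_typical hP hent M htyp hl hm hp τ (hits τ) ?_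
    intro ω x hx q1 q2 q3
    exact Finset.mem_filter.mpr ⟨Finset.mem_univ _, x, fun t => hsupp _ (hx t), q1, q2, q3⟩
  set D : ℝ := (a + b + c) * M + 1 with hD
  have hD0 : 0 ≤ D := by positivity
  set s := ⌈G * D⌉₊ with hs
  have hsmall : Fintype.card (Fin l × Fin m × Fin p) * (1 - 1 / G) ^ s < 1 := by
    have hcard : (Fintype.card (Fin l × Fin m × Fin p) : ℝ) ≤ 2 ^ ((a + b + c) * M) := by
      simp only [Fintype.card_prod, Fintype.card_fin]
      push_cast
      rw [add_mul, add_mul, Real.rpow_add (by norm_num), Real.rpow_add (by norm_num), ← mul_assoc]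
      gcongr
    have hsub : 0 ≤ 1 - 1 / G := by
      rw [sub_nonneg, div_le_one hG0]
      exact hG1
    have hpow : (1 - 1 / G) ^ s ≤ Real.exp (-D) := by
      calc (1 - 1 / G) ^ s ≤ Real.exp (-(1 / G)) ^ s :=
            pow_le_pow_left₀ hsub (Real.one_sub_le_exp_neg _) s
        _ = Real.exp (s * -(1 / G)) := (Real.exp_nat_mul _ _).symm
        _ ≤ Real.exp (-D) := by
            refine Real.exp_le_exp.mpr ?_
            have : G * D ≤ s := Nat.le_ceil _
            rw [mul_neg, neg_le_neg_iff, mul_one_div, le_div_iff₀ hG0]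
            linarith
    calc _ ≤ (2 : ℝ) ^ ((a + b + c) * M) * Real.exp (-D) :=
          mul_le_mul hcard hpow (pow_nonneg hsub s) (by positivity)
      _ = Real.exp (Real.log 2 * ((a + b + c) * M) - D) := by
          rw [Real.rpow_def_of_pos (by norm_num), ← Real.exp_add, sub_eq_add_neg]
      _ < 1 := by
          rw [Real.exp_lt_one_iff]
          have h0 : 0 ≤ (a + b + c) * M := by positivity
          have : Real.log 2 ≤ 1 := by linarith [Real.log_two_lt_d9]
          nlinarith
  obtain ⟨ω, hω⟩ := exists_cover hits (1 / G) hhits s hsmall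
  have hrank := supportRank_MMSupport_le_of_cover F Λ ω fun τ => by
    obtain ⟨r, hr⟩ := hω τ
    exact ⟨r, (Finset.mem_filter.mp hr).2⟩
  have hrank' : (SupportRank F (MMSupport l m p) : ℝ) ≤
      s * SupportRank F (PowSupport (PMMSupport Λ) M) := by exact_mod_cast hrank
  refine hrank'.trans (mul_le_mul_of_nonneg_right ?_ (Nat.cast_nonneg _))
  have hsle : (s : ℝ) ≤ G * D + 1 := (Nat.ceil_lt_add_one (by positivity)).le
  have h22 : (2 : ℝ) ^ (2 * ε * M) = 2 ^ (ε * M) * 2 ^ (ε * M) := by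
    rw [← Real.rpow_add (by norm_num)]
    ring_nf
  rw [h22]
  nlinarith

end MatrixMultiplication
theorem one_le_asymptoticSupportRank (F : Type*) [Field F] {X Y Z : Type*} [Finite X] [Finite Y]
    [Finite Z] {Φ : Set (X × Y × Z)} (hΦ : Φ.Nonempty) : 1 ≤ AsymptoticSupportRank F Φ := by
  refine le_csInf ⟨_, 1, one_pos, rfl⟩ ?_
  rintro x ⟨n, hn, rfl⟩
  refine Real.one_le_rpow ?_ (by positivity)
  exact_mod_cast supportRank_pos F (PowSupport.nonempty hΦ n)

theorem asymptoticSupportRank_le_supportRank (F : Type*) [Field F] {X Y Z : Type*} [Finite X]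
    [Finite Y] [Finite Z] (Φ : Set (X × Y × Z)) :
    AsymptoticSupportRank F Φ ≤ SupportRank F Φ := by
  have h1 : AsymptoticSupportRank F Φ ≤
      (SupportRank F (PowSupport Φ 1) : ℝ) ^ ((1 : ℝ) / (1 : ℕ)) := by
    refine csInf_le ⟨0, ?_⟩ ⟨1, one_pos, rfl⟩
    rintro x ⟨n, hn, rfl⟩
    positivity
  refine h1.trans ?_
  simpa using supportRank_powSupport_le F Φ 1

/-- Some power of `Φ` witnesses the asymptotic support rank up to `ε` in the exponent. -/
theorem exists_logb_supportRank_powSupport_le (F : Type*) [Field F] {X Y Z : Type*} [Finite X]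
    [Finite Y] [Finite Z] {Φ : Set (X × Y × Z)} (hΦ : Φ.Nonempty) {ε : ℝ} (hε : 0 < ε) :
    ∃ N : ℕ, 0 < N ∧ Real.logb 2 (SupportRank F (PowSupport Φ N)) / N ≤
      Real.logb 2 (AsymptoticSupportRank F Φ) + ε := by
  have hA := one_le_asymptoticSupportRank F hΦ
  have hlt : AsymptoticSupportRank F Φ < AsymptoticSupportRank F Φ * 2 ^ ε :=
    lt_mul_of_one_lt_right (by linarith) (Real.one_lt_rpow (by norm_num) hε)
  have hne : {x : ℝ | ∃ n : ℕ, 0 < n ∧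
      x = (SupportRank F (PowSupport Φ n) : ℝ) ^ ((1 : ℝ) / n)}.Nonempty := ⟨_, 1, one_pos, rfl⟩
  obtain ⟨x, ⟨N, hN, rfl⟩, hx⟩ := exists_lt_of_csInf_lt hne hlt
  have hR : (0 : ℝ) < SupportRank F (PowSupport Φ N) := by
    exact_mod_cast supportRank_pos F (PowSupport.nonempty hΦ N)
  refine ⟨N, hN, ?_⟩
  have := Real.logb_le_logb_of_le (b := 2) (by norm_num) (by positivity) hx.le
  rw [Real.logb_rpow_eq_mul_logb_of_pos hR, Real.logb_mul (by positivity) (by positivity),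
    Real.logb_rpow (by norm_num) (by norm_num)] at this
  rwa [div_eq_inv_mul, ← one_div]

theorem omegaS_le_log_asymptoticSupportRank_pmm
    (F : Type*) [Field F] [Infinite F]
    {I J K : Type*} [Fintype I] [Fintype J] [Fintype K]
    (Λ : Set (I × J × K)) (hΛ : Λ.Nonempty)
    (P : I × J × K → ℝ) (hP : IsProbDist P)
    (hsupp : ∀ q : I × J × K, P q ≠ 0 → q ∈ Λ)
    (a b c : ℝ) (ha : 0 ≤ a) (hb : 0 ≤ b) (hc : 0 ≤ c)
    (h1 : a ≤ entropy (margI P))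
    (h2 : b ≤ entropy (margJ P))
    (h3 : c ≤ entropy (margK P))
    (h4 : a + b ≤ entropy (margIJ P))
    (h5 : a + c ≤ entropy (margIK P))
    (h6 : b + c ≤ entropy (margJK P))
    (h7 : a + b + c ≤ entropy P) :
    omegaS F a b c ≤ Real.logb 2 (AsymptoticSupportRank F (PMMSupport Λ)) ∧
    Real.logb 2 (AsymptoticSupportRank F (PMMSupport Λ)) ≤
      Real.logb 2 (SupportRank F (PMMSupport Λ)) := by
  have hΦ := PMMSupport.nonempty hΛ
  have hA := one_le_asymptoticSupportRank F hΦ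
  refine ⟨?_, Real.logb_le_logb_of_le (by norm_num) (by linarith)
    (asymptoticSupportRank_le_supportRank F _)⟩
  refine le_of_forall_pos_le_add fun δ hδ => ?_
  set ε := δ / 4 with hεδ
  have hε : 0 < ε := by positivity
  obtain ⟨N, hN, hNle⟩ := exists_logb_supportRank_powSupport_le F hΦ hε
  set R := SupportRank F (PowSupport (PMMSupport Λ) N) with hRdef
  have hR : 0 < R := supportRank_pos F (PowSupport.nonempty hΦ N)
  have hlogR : 0 ≤ Real.logb 2 R := Real.logb_nonneg (by norm_num) (by exact_mod_cast hR)
  have hev := eventually_supportRank_MMSupport_le F Λ P hP hsupp a b c ha hb hc h1 h2 h3 h4 h5 h6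
    h7 hε
  have hN' : (0 : ℝ) < N := by exact_mod_cast hN
  have hqtend : Filter.Tendsto (fun n : ℕ => (n / N + 1) * N) Filter.atTop Filter.atTop :=
    Filter.tendsto_atTop_mono (fun n => (Nat.lt_div_mul_add hN (a := n)).le.trans
      (by rw [add_mul, one_mul])) Filter.tendsto_id
  refine Filter.limsup_le_of_le ?_ ?_
  · refine Filter.isCoboundedUnder_le_of_le Filter.atTop (x := 0) fun n => ?_
    refine mul_nonneg (by positivity) ?_
    rcases Nat.eq_zero_or_pos (SupportRank F (MMSupport ⌊(2 : ℝ) ^ (a * n)⌋₊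
      ⌊(2 : ℝ) ^ (b * n)⌋₊ ⌊(2 : ℝ) ^ (c * n)⌋₊)) with h0 | hpos
    · simp [h0]
    · exact Real.logb_nonneg (by norm_num) (by exact_mod_cast hpos)
  filter_upwards [hqtend.eventually hev, Filter.eventually_gt_atTop 0,
    Filter.eventually_ge_atTop ⌈(2 * ε * N + Real.logb 2 R) / ε⌉₊] with n hn hn0 hnlarge
  have hn0' : (0 : ℝ) < n := by exact_mod_cast hn0
  set q := n / N + 1 with hq
  have hnM : n ≤ q * N := by
    rw [hq, add_mul, one_mul]
    exact (Nat.lt_div_mul_add hN).le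
  have hnM' : (n : ℝ) ≤ ((q * N : ℕ) : ℝ) := by exact_mod_cast hnM
  have hqle : (q : ℝ) ≤ n / N + 1 := by
    rw [hq]
    push_cast
    linarith [Nat.cast_div_le (α := ℝ) (m := n) (n := N)]
  have hfloor0 : ∀ e : ℝ, 0 ≤ e → 0 < ⌊(2 : ℝ) ^ (e * n)⌋₊ := fun e he =>
    Nat.floor_pos.mpr (Real.one_le_rpow (by norm_num) (by positivity))
  have hfloor : ∀ e : ℝ, 0 ≤ e → (⌊(2 : ℝ) ^ (e * n)⌋₊ : ℝ) ≤ 2 ^ (e * (q * N : ℕ)) :=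
    fun e he => (Nat.floor_le (by positivity)).trans
      (Real.rpow_le_rpow_of_exponent_le (by norm_num) (mul_le_mul_of_nonneg_left hnM' he))
  have hrank := hn _ _ _ (hfloor0 a ha) (hfloor0 b hb) (hfloor0 c hc) (hfloor a ha) (hfloor b hb)
    (hfloor c hc)
  have hpow : (SupportRank F (PowSupport (PMMSupport Λ) (q * N)) : ℝ) ≤ (R : ℝ) ^ q := by
    exact_mod_cast supportRank_powSupport_mul_le F (PMMSupport Λ) q N
  set L := SupportRank F (MMSupport ⌊(2 : ℝ) ^ (a * n)⌋₊ ⌊(2 : ℝ) ^ (b * n)⌋₊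
    ⌊(2 : ℝ) ^ (c * n)⌋₊) with hL
  have hLle : (L : ℝ) ≤ 2 ^ (2 * ε * (q * N : ℕ)) * (R : ℝ) ^ q :=
    hrank.trans (mul_le_mul_of_nonneg_left hpow (by positivity))
  have hR' : (0 : ℝ) < R := by exact_mod_cast hR
  have hL0 : (0 : ℝ) < L := by
    have : (MMSupport ⌊(2 : ℝ) ^ (a * n)⌋₊ ⌊(2 : ℝ) ^ (b * n)⌋₊ ⌊(2 : ℝ) ^ (c * n)⌋₊).Nonempty :=
      ⟨_, ⟨0, hfloor0 a ha⟩, ⟨0, hfloor0 b hb⟩, ⟨0, hfloor0 c hc⟩, rfl⟩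
    exact_mod_cast supportRank_pos F this
  have hlog := Real.logb_le_logb_of_le (b := 2) (by norm_num) hL0 hLle
  rw [Real.logb_mul (by positivity) (by positivity), Real.logb_rpow (by norm_num) (by norm_num),
    Real.logb_pow] at hlog
  have hlarge : 2 * ε * N + Real.logb 2 R ≤ n * ε := by
    have := Nat.ceil_le.mp hnlarge
    rwa [div_le_iff₀ hε] at this
  have hqN : ((q * N : ℕ) : ℝ) ≤ n + N := by
    push_cast
    calc (q : ℝ) * N ≤ (n / N + 1) * N := by gcongr
      _ = n + N := by field_simp
  have hqR : q * Real.logb 2 R ≤ n * (Real.logb 2 R / N) + Real.logb 2 R := by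
    calc q * Real.logb 2 R ≤ (n / N + 1) * Real.logb 2 R := by gcongr
      _ = _ := by ring
  have hnR := mul_le_mul_of_nonneg_left hNle hn0'.le
  have hεq := mul_le_mul_of_nonneg_left hqN (show 0 ≤ 2 * ε by positivity)
  rw [one_div, ← div_eq_inv_mul, div_le_iff₀ hn0']
  have hδε : δ = 4 * ε := by rw [hεδ]; ring
  rw [hδε]
  linarith
end

section
/- Let F be an infinite field, I, J, K finite sets, and Λ ⊆ I × J × K with |Λ| ≥ 2. Then ω_s ≤ 3 · log₂ R_s(Φ(Λ)) / log₂ |Λ|. -/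
open scoped BigOperators

/-- `Φ` is the support of a tensor that is a sum of `r` rank-one tensors. -/
def SupportRankLE (F : Type*) [Field F] {X Y Z : Type*} (Φ : Set (X × Y × Z)) (r : ℕ) : Prop :=
  ∃ (a : Fin r → X → F) (b : Fin r → Y → F) (c : Fin r → Z → F),
    ∀ q, ∑ m, a m q.1 * b m q.2.1 * c m q.2.2 ≠ 0 ↔ q ∈ Φ

/-- The set of triples of tuples all of whose coordinate triples lie in `Λ`. -/
def triplePower {I J K : Type*} (Λ : Set (I × J × K)) (N : ℕ) :
    Set ((Fin N → I) × (Fin N → J) × (Fin N → K)) :=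
  {p | ∀ n, (p.1 n, p.2.1 n, p.2.2 n) ∈ Λ}

section SupportRank

variable {F : Type*} [Field F] {X Y Z I J K A B C : Type*}

theorem SupportRankLE.of_fintype {Φ : Set (X × Y × Z)} {ι : Type*} [Fintype ι]
    (a : ι → X → F) (b : ι → Y → F) (c : ι → Z → F)
    (h : ∀ q, ∑ m, a m q.1 * b m q.2.1 * c m q.2.2 ≠ 0 ↔ q ∈ Φ) :
    SupportRankLE F Φ (Fintype.card ι) := by
  let e := (Fintype.equivFin ι).symm
  refine ⟨fun m => a (e m), fun m => b (e m), fun m => c (e m), fun q => ?_⟩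
  rw [← h q, e.sum_comp (fun m => a m q.1 * b m q.2.1 * c m q.2.2)]

theorem SupportRankLE.supportRank_le {Φ : Set (X × Y × Z)} {r : ℕ} (h : SupportRankLE F Φ r) :
    SupportRank F Φ ≤ r := by
  obtain ⟨a, b, c, h⟩ := h
  have hle : SupportRank F Φ ≤ TensorRank F fun q => ∑ m, a m q.1 * b m q.2.1 * c m q.2.2 :=
    Nat.sInf_le ⟨_, Set.ext h, rfl⟩
  exact hle.trans (Nat.sInf_le ⟨a, b, c, fun _ => rfl⟩)

theorem exists_tensorRank_decomposition [Finite X] [Finite Y] [Finite Z] (t : X × Y × Z → F) :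
    ∃ (a : Fin (TensorRank F t) → X → F) (b : Fin (TensorRank F t) → Y → F)
      (c : Fin (TensorRank F t) → Z → F),
      ∀ q : X × Y × Z, t q = ∑ m, a m q.1 * b m q.2.1 * c m q.2.2 := by
  classical
  cases nonempty_fintype X
  cases nonempty_fintype Y
  cases nonempty_fintype Z
  refine Nat.sInf_mem (s := {L : ℕ | ∃ (a : Fin L → X → F) (b : Fin L → Y → F) (c : Fin L → Z → F),
    ∀ q : X × Y × Z, t q = ∑ m, a m q.1 * b m q.2.1 * c m q.2.2}) ?_
  let e := (Fintype.equivFin (X × Y × Z)).symm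
  refine ⟨_, fun m x => if x = (e m).1 then t (e m) else 0,
    fun m y => if y = (e m).2.1 then 1 else 0, fun m z => if z = (e m).2.2 then 1 else 0, fun q => ?_⟩
  rw [e.sum_comp (fun p : X × Y × Z => (if q.1 = p.1 then t p else 0) *
    (if q.2.1 = p.2.1 then 1 else 0) * (if q.2.2 = p.2.2 then 1 else 0)),
    Finset.sum_eq_single q]
  · simp
  · rintro p - hp
    by_contra h
    refine hp ?_
    simp only [mul_ite, mul_one, mul_zero, ite_eq_right_iff, not_forall] at h
    obtain ⟨h₁, h₂, h₃, -⟩ := h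
    exact Prod.ext h₃.symm (Prod.ext h₂.symm h₁.symm)
  · simp

theorem supportRankLE_supportRank [Finite X] [Finite Y] [Finite Z] (Φ : Set (X × Y × Z)) :
    SupportRankLE F Φ (SupportRank F Φ) := by
  classical
  have hne : (TensorRank F '' {t : X × Y × Z → F | {q | t q ≠ 0} = Φ}).Nonempty :=
    ⟨_, fun q => if q ∈ Φ then 1 else 0, by ext q; simp, rfl⟩
  obtain ⟨t, ht, hr⟩ := Nat.sInf_mem hne
  obtain ⟨a, b, c, h⟩ := exists_tensorRank_decomposition t
  rw [SupportRank, ← hr]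
  refine ⟨a, b, c, fun q => ?_⟩
  rw [← h q, ← ht]
  rfl

theorem SupportRankLE.pos {Φ : Set (X × Y × Z)} {r : ℕ} (h : SupportRankLE F Φ r)
    (hΦ : Φ.Nonempty) : 0 < r := by
  obtain ⟨a, b, c, h⟩ := h
  obtain ⟨q, hq⟩ := hΦ
  rw [Nat.pos_iff_ne_zero]
  rintro rfl
  simpa using (h q).2 hq

theorem SupportRankLE.prod {I' J' K' : Type*} {Λ : Set (I × J × K)} {Λ' : Set (I' × J' × K')}
    {r r' : ℕ} (h : SupportRankLE F (PMMSupport Λ) r) (h' : SupportRankLE F (PMMSupport Λ') r') :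
    SupportRankLE F (PMMSupport {p : (I × I') × (J × J') × (K × K') |
      (p.1.1, p.2.1.1, p.2.2.1) ∈ Λ ∧ (p.1.2, p.2.1.2, p.2.2.2) ∈ Λ'}) (r * r') := by
  obtain ⟨a, b, c, h⟩ := h
  obtain ⟨a', b', c', h'⟩ := h'
  have key := SupportRankLE.of_fintype (ι := Fin r × Fin r')
    (Φ := PMMSupport {p : (I × I') × (J × J') × (K × K') |
      (p.1.1, p.2.1.1, p.2.2.1) ∈ Λ ∧ (p.1.2, p.2.1.2, p.2.2.2) ∈ Λ'})
    (fun m e => a m.1 (e.1.1, e.2.1) * a' m.2 (e.1.2, e.2.2))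
    (fun m e => b m.1 (e.1.1, e.2.1) * b' m.2 (e.1.2, e.2.2))
    (fun m e => c m.1 (e.1.1, e.2.1) * c' m.2 (e.1.2, e.2.2)) ?_
  · simpa using key
  rintro ⟨⟨⟨i, i'⟩, j, j'⟩, ⟨⟨j₁, j₁'⟩, k, k'⟩, ⟨k₁, k₁'⟩, i₁, i₁'⟩
  have h₁ := h ((i, j), (j₁, k), (k₁, i₁))
  have h₂ := h' ((i', j'), (j₁', k'), (k₁', i₁'))
  have hsum : ∑ m : Fin r × Fin r', a m.1 (i, j) * a' m.2 (i', j') *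
      (b m.1 (j₁, k) * b' m.2 (j₁', k')) * (c m.1 (k₁, i₁) * c' m.2 (k₁', i₁')) =
      (∑ m, a m (i, j) * b m (j₁, k) * c m (k₁, i₁)) *
        ∑ m, a' m (i', j') * b' m (j₁', k') * c' m (k₁', i₁') := by
    rw [Finset.sum_mul_sum, Fintype.sum_prod_type]
    refine Finset.sum_congr rfl fun m _ => Finset.sum_congr rfl fun m' _ => ?_
    ring
  dsimp only at h₁ h₂ ⊢
  rw [hsum, mul_ne_zero_iff, h₁, h₂]
  constructor
  · rintro ⟨⟨_, _, _, hΛ, e⟩, _, _, _, hΛ', e'⟩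
    simp only [Prod.mk.injEq] at e e'
    obtain ⟨⟨rfl, rfl⟩, ⟨rfl, rfl⟩, rfl, rfl⟩ := e
    obtain ⟨⟨rfl, rfl⟩, ⟨rfl, rfl⟩, rfl, rfl⟩ := e'
    exact ⟨_, _, _, ⟨hΛ, hΛ'⟩, rfl⟩
  · rintro ⟨⟨_, _⟩, ⟨_, _⟩, ⟨_, _⟩, ⟨hΛ, hΛ'⟩, e⟩
    simp only [Prod.mk.injEq] at e
    obtain ⟨⟨⟨rfl, rfl⟩, rfl, rfl⟩, ⟨⟨rfl, rfl⟩, rfl, rfl⟩, ⟨rfl, rfl⟩, rfl, rfl⟩ := e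
    exact ⟨⟨_, _, _, hΛ, rfl⟩, _, _, _, hΛ', rfl⟩

theorem SupportRankLE.pow {Λ : Set (I × J × K)} {r : ℕ} (h : SupportRankLE F (PMMSupport Λ) r)
    (N : ℕ) : SupportRankLE F (PMMSupport (triplePower Λ N)) (r ^ N) := by
  obtain ⟨a, b, c, h⟩ := h
  have key := SupportRankLE.of_fintype (ι := Fin N → Fin r) (Φ := PMMSupport (triplePower Λ N))
    (fun m e => ∏ n, a (m n) (e.1 n, e.2 n)) (fun m e => ∏ n, b (m n) (e.1 n, e.2 n))
    (fun m e => ∏ n, c (m n) (e.1 n, e.2 n)) ?_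
  · simpa using key
  rintro ⟨⟨i, j⟩, ⟨j', k⟩, k', i'⟩
  simp only [← Finset.prod_mul_distrib]
  rw [← Fintype.piFinset_univ, ← Finset.prod_univ_sum (fun _ => Finset.univ)
    (fun n m => a m (i n, j n) * b m (j' n, k n) * c m (k' n, i' n)), Finset.prod_ne_zero_iff]
  have h₁ n := h ((i n, j n), (j' n, k n), (k' n, i' n))
  dsimp only at h₁
  simp only [h₁, Finset.mem_univ, true_imp_iff]
  constructor
  · intro H
    have H' n : (i n, j n, k n) ∈ Λ ∧ j' n = j n ∧ k' n = k n ∧ i' n = i n := by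
      obtain ⟨_, _, _, hΛ, e⟩ := H n
      simp only [Prod.mk.injEq] at e
      obtain ⟨⟨e₁, e₂⟩, ⟨e₃, e₄⟩, e₅, e₆⟩ := e
      rw [e₁, e₂, e₃, e₄, e₅, e₆]
      exact ⟨hΛ, rfl, rfl, rfl⟩
    obtain rfl : j' = j := funext fun n => (H' n).2.1
    obtain rfl : k' = k := funext fun n => (H' n).2.2.1
    obtain rfl : i' = i := funext fun n => (H' n).2.2.2
    exact ⟨_, _, _, fun n => (H' n).1, rfl⟩
  · rintro ⟨_, _, _, hΛ, e⟩ n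
    simp only [Prod.mk.injEq] at e
    obtain ⟨⟨rfl, rfl⟩, ⟨rfl, rfl⟩, rfl, rfl⟩ := e
    exact ⟨_, _, _, hΛ n, rfl⟩

theorem SupportRankLE.rotate {r : ℕ}
    (h : SupportRankLE F (PMMSupport (Set.univ : Set (A × B × C))) r) :
    SupportRankLE F (PMMSupport (Set.univ : Set (B × C × A))) r := by
  obtain ⟨a, b, c, h⟩ := h
  refine ⟨b, c, a, ?_⟩
  rintro ⟨⟨j, k⟩, ⟨k', i⟩, i', j'⟩
  have h₁ := h ((i', j'), (j, k), (k', i))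
  dsimp only at h₁ ⊢
  rw [Finset.sum_congr rfl fun m _ => (mul_rotate (a m (i', j')) (b m (j, k)) (c m (k', i))).symm, h₁]
  constructor
  · rintro ⟨_, _, _, -, e⟩
    simp only [Prod.mk.injEq] at e
    obtain ⟨⟨rfl, rfl⟩, ⟨rfl, rfl⟩, rfl, rfl⟩ := e
    exact ⟨_, _, _, trivial, rfl⟩
  · rintro ⟨_, _, _, -, e⟩
    simp only [Prod.mk.injEq] at e
    obtain ⟨⟨rfl, rfl⟩, ⟨rfl, rfl⟩, rfl, rfl⟩ := e
    exact ⟨_, _, _, trivial, rfl⟩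

theorem exists_forall_sum_mul_ne_zero [Infinite F] {P V : Type*} [Finite P] [Fintype V]
    (w : P → V → F) (hw : ∀ p, ∃ x, w p x ≠ 0) : ∃ u : V → F, ∀ p, ∑ x, u x * w p x ≠ 0 := by
  classical
  obtain ⟨u, hu⟩ := Module.Dual.exists_forall_ne_zero_of_forall_exists
    (fun p => (Fintype.linearCombination F (w p) : Module.Dual F (V → F))) fun p => by
      obtain ⟨x, hx⟩ := hw p
      exact ⟨Pi.single x 1, by simpa using hx⟩
  exact ⟨u, fun p => by simpa [Fintype.linearCombination_apply] using hu p⟩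

theorem exists_forall_sum_sum_mul_ne_zero [Infinite F] {P V W : Type*} [Finite P] [Fintype V]
    [Fintype W] (w : P → V → W → F) (hw : ∀ p, ∃ x y, w p x y ≠ 0) :
    ∃ (u : V → F) (v : W → F), ∀ p, ∑ x, ∑ y, u x * v y * w p x y ≠ 0 := by
  obtain ⟨v, hv⟩ := exists_forall_sum_mul_ne_zero
    (fun (px : {px : P × V // ∃ y, w px.1 px.2 y ≠ 0}) y => w px.1.1 px.1.2 y) fun px => px.2
  obtain ⟨u, hu⟩ := exists_forall_sum_mul_ne_zero (fun p x => ∑ y, v y * w p x y) fun p => by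
    obtain ⟨x, hx⟩ := hw p
    exact ⟨x, hv ⟨(p, x), hx⟩⟩
  refine ⟨u, v, fun p => ?_⟩
  simpa only [Finset.mul_sum, mul_assoc] using hu p

theorem sum_sum_ite_mul_sum_ite_mul_sum_ite [Fintype X] [Fintype Y] [Fintype Z] {ι : Type*}
    [Fintype ι] (a : ι → X → F) (b : ι → Y → F) (c : ι → Z → F) (p : X → Prop) (q : Y → Prop)
    (s : Z → Prop) [DecidablePred p] [DecidablePred q] [DecidablePred s] (α : X → F) (β : Y → F) :
    ∑ m, (∑ x, if p x then α x * a m x else 0) * (∑ y, if q y then β y * b m y else 0) *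
        (∑ z, if s z then c m z else 0) =
      ∑ z : X × Y × Z, if p z.1 ∧ q z.2.1 ∧ s z.2.2 then
        α z.1 * β z.2.1 * ∑ m, a m z.1 * b m z.2.1 * c m z.2.2 else 0 := by
  have hterm (z : X × Y × Z) : (if p z.1 ∧ q z.2.1 ∧ s z.2.2 then
        α z.1 * β z.2.1 * ∑ m, a m z.1 * b m z.2.1 * c m z.2.2 else 0) =
      ∑ m, (if p z.1 then α z.1 * a m z.1 else 0) * (if q z.2.1 then β z.2.1 * b m z.2.1 else 0) *
        (if s z.2.2 then c m z.2.2 else 0) := by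
    by_cases hp : p z.1 <;> by_cases hq : q z.2.1 <;> by_cases hs : s z.2.2 <;>
      simp only [hp, hq, hs, and_self, and_true, and_false, if_true, if_false, mul_zero, zero_mul,
        Finset.sum_const_zero]
    rw [Finset.mul_sum]
    exact Finset.sum_congr rfl fun m _ => by ring
  simp only [hterm]
  rw [Finset.sum_comm]
  refine Finset.sum_congr rfl fun m _ => ?_
  rw [mul_assoc, Fintype.sum_mul_sum, Fintype.sum_mul_sum, Fintype.sum_prod_type]
  simp only [Fintype.sum_prod_type, Finset.mul_sum, mul_assoc]

/-- If finitely many images of `Λ` under products of maps cover a box, then generic linear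
combinations of the corresponding specializations have full matrix multiplication support. -/
theorem SupportRankLE.of_cover [Infinite F] [Fintype I] [Fintype J] [Fintype K]
    [Finite A] [Finite B] [Finite C] {σ : Type*} [Fintype σ] {Λ : Set (I × J × K)} {r : ℕ}
    (hr : SupportRankLE F (PMMSupport Λ) r) (f : σ → I → A) (g : σ → J → B) (h : σ → K → C)
    (hcov : ∀ p q s, ∃ x i j k, (i, j, k) ∈ Λ ∧ f x i = p ∧ g x j = q ∧ h x k = s) :
    SupportRankLE F (PMMSupport (Set.univ : Set (A × B × C))) (Fintype.card σ * r) := by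
  classical
  obtain ⟨a, b, c, hr⟩ := hr
  set t : (I × J) × (J × K) × (K × I) → F := fun q => ∑ m, a m q.1 * b m q.2.1 * c m q.2.2 with ht
  obtain ⟨u, v, huv⟩ := exists_forall_sum_sum_mul_ne_zero
    (fun (p : A × B × C) (x : σ × I × J) (k : K) =>
      if f x.1 x.2.1 = p.1 ∧ g x.1 x.2.2 = p.2.1 ∧ h x.1 k = p.2.2 then
        t ((x.2.1, x.2.2), (x.2.2, k), (k, x.2.1)) else 0) fun p => by
      obtain ⟨x, i, j, k, hΛ, h₁, h₂, h₃⟩ := hcov p.1 p.2.1 p.2.2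
      refine ⟨(x, i, j), k, ?_⟩
      dsimp only
      rw [if_pos ⟨h₁, h₂, h₃⟩]
      exact (hr _).2 ⟨i, j, k, hΛ, rfl⟩
  have key := SupportRankLE.of_fintype (ι := σ × Fin r)
    (Φ := PMMSupport (Set.univ : Set (A × B × C)))
    (fun m P => ∑ e : I × J, if (f m.1 e.1, g m.1 e.2) = P then u (m.1, e) * a m.2 e else 0)
    (fun m P => ∑ e : J × K, if (g m.1 e.1, h m.1 e.2) = P then v e.2 * b m.2 e else 0)
    (fun m P => ∑ e : K × I, if (h m.1 e.1, f m.1 e.2) = P then c m.2 e else 0) ?_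
  · simpa using key
  rintro ⟨P, Q, S⟩
  dsimp only
  let G : σ × (I × J) × (J × K) × (K × I) → F := fun z =>
    if (f z.1 z.2.1.1, g z.1 z.2.1.2) = P ∧ (g z.1 z.2.2.1.1, h z.1 z.2.2.1.2) = Q ∧
      (h z.1 z.2.2.2.1, f z.1 z.2.2.2.2) = S then u (z.1, z.2.1) * v z.2.2.1.2 * t z.2 else 0
  have hG : ∑ m : σ × Fin r,
      (∑ e : I × J, if (f m.1 e.1, g m.1 e.2) = P then u (m.1, e) * a m.2 e else 0) *
      (∑ e : J × K, if (g m.1 e.1, h m.1 e.2) = Q then v e.2 * b m.2 e else 0) *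
      (∑ e : K × I, if (h m.1 e.1, f m.1 e.2) = S then c m.2 e else 0) = ∑ z, G z := by
    rw [Fintype.sum_prod_type, Fintype.sum_prod_type]
    exact Finset.sum_congr rfl fun x _ => sum_sum_ite_mul_sum_ite_mul_sum_ite a b c
      (fun e => (f x e.1, g x e.2) = P) (fun e => (g x e.1, h x e.2) = Q)
      (fun e => (h x e.1, f x e.2) = S) (fun e => u (x, e)) (fun e => v e.2)
  rw [hG]
  have htz q (hq : t q ≠ 0) : ∃ i j k, q = ((i, j), (j, k), (k, i)) := by
    obtain ⟨i, j, k, -, e⟩ := (hr q).1 hq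
    exact ⟨i, j, k, e⟩
  constructor
  · intro hne
    obtain ⟨⟨x, q⟩, -, hz⟩ := Finset.exists_ne_zero_of_sum_ne_zero hne
    simp only [G, ne_eq, ite_eq_right_iff, not_forall] at hz
    obtain ⟨⟨rfl, rfl, rfl⟩, hz⟩ := hz
    obtain ⟨i, j, k, rfl⟩ := htz q (right_ne_zero_of_mul hz)
    exact ⟨_, _, _, trivial, rfl⟩
  · rintro ⟨p, q, s, -, e⟩
    simp only [Prod.mk.injEq] at e
    obtain ⟨rfl, rfl, rfl⟩ := e
    have := huv (p, q, s)
    rw [← Fintype.sum_prod_type'] at this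
    convert this using 1
    symm
    refine Fintype.sum_of_injective (fun y : (σ × I × J) × K =>
      (y.1.1, (y.1.2.1, y.1.2.2), (y.1.2.2, y.2), (y.2, y.1.2.1))) ?_ _ _ ?_ ?_
    · rintro ⟨⟨x, i, j⟩, k⟩ ⟨⟨x', i', j'⟩, k'⟩ hy
      simp only [Prod.mk.injEq] at hy ⊢
      tauto
    · rintro ⟨x, y⟩ hz
      by_contra hne
      simp only [G, ite_eq_right_iff, not_forall] at hne
      obtain ⟨-, hne⟩ := hne
      obtain ⟨i, j, k, rfl⟩ := htz y (right_ne_zero_of_mul hne)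
      exact hz ⟨((x, i, j), k), rfl⟩
    · rintro ⟨⟨x, i, j⟩, k⟩
      simp only [G, mul_ite, mul_zero, Prod.mk.injEq]
      congr 1
      apply propext
      tauto

theorem SupportRankLE.of_surjective [Infinite F] [Fintype I] [Fintype J] [Fintype K]
    [Finite A] [Finite B] [Finite C] {r : ℕ}
    (hr : SupportRankLE F (PMMSupport (Set.univ : Set (I × J × K))) r) {f : I → A} {g : J → B}
    {h : K → C} (hf : f.Surjective) (hg : g.Surjective) (hh : h.Surjective) :
    SupportRankLE F (PMMSupport (Set.univ : Set (A × B × C))) r := by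
  have := hr.of_cover (σ := Unit) (fun _ => f) (fun _ => g) (fun _ => h) fun p q s => by
    obtain ⟨i, rfl⟩ := hf p
    obtain ⟨j, rfl⟩ := hg q
    obtain ⟨k, rfl⟩ := hh s
    exact ⟨(), i, j, k, trivial, rfl, rfl, rfl⟩
  simpa using this

end SupportRank

section Combinatorics

theorem two_mul_pow_le_succ_pow {d s : ℕ} (h : d + 1 ≤ s) : 2 * d ^ s ≤ (d + 1) ^ s := by
  have key : ∀ s, d ^ s * (d + s) ≤ d * (d + 1) ^ s := fun s => by
    induction s with
    | zero => simp
    | succ s ih =>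
      calc d ^ (s + 1) * (d + (s + 1)) = d * (d ^ s * (d + s)) + d * d ^ s := by ring
        _ ≤ d * (d * (d + 1) ^ s) + d * (d + 1) ^ s := by gcongr; exact Nat.le_succ d
        _ = d * (d + 1) ^ (s + 1) := by ring
  rcases Nat.eq_zero_or_pos d with rfl | hd
  · simp [zero_pow (show s ≠ 0 by lia)]
  · refine Nat.le_of_mul_le_mul_left ?_ hd
    calc d * (2 * d ^ s) = d ^ s * (d + d) := by ring
      _ ≤ d ^ s * (d + s) := by gcongr; lia
      _ ≤ _ := key s

/-- Logarithmically many maps to `Fin b` suffice to map each of a family of sets of size at least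
`b` jointly onto `Fin b`. -/
theorem exists_hash_family {X J : Type*} [Fintype X] [Fintype J] (S : X → Finset J) {b T : ℕ}
    (hb : 0 < b) (hS : ∀ x, b ≤ (S x).card) (hT : Fintype.card X * b < 2 ^ T) :
    ∃ g : Fin T → J → Fin b, ∀ x y, ∃ s, ∃ j ∈ S x, g s j = y := by
  classical
  by_contra! hbad
  let bad : X × Fin b → Finset (Fin T → J → Fin b) := fun p =>
    Fintype.piFinset fun _ => Fintype.piFinset fun j =>
      if j ∈ S p.1 then Finset.univ.erase p.2 else Finset.univ
  have hcard p : (bad p).card * 2 ^ T ≤ (b ^ Fintype.card J) ^ T := by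
    simp only [bad, Fintype.card_piFinset, Finset.prod_const, Finset.card_univ, Fintype.card_fin]
    rw [← mul_pow]
    refine Nat.pow_le_pow_left ?_ T
    have hterm (j : J) : (if j ∈ S p.1 then Finset.univ.erase p.2 else Finset.univ).card =
        if j ∈ S p.1 then b - 1 else b := by
      split_ifs <;> simp
    simp only [hterm]
    rw [Finset.prod_ite, Finset.prod_const, Finset.prod_const]
    obtain ⟨d, rfl⟩ : ∃ d, b = d + 1 := ⟨b - 1, by lia⟩
    have hsum := Finset.card_filter_add_card_filter_not (s := (Finset.univ : Finset J))
      (fun j => j ∈ S p.1)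
    have hle : d + 1 ≤ (Finset.univ.filter fun j => j ∈ S p.1).card := by
      simpa using hS p.1
    rw [Finset.card_univ] at hsum
    rw [← hsum, pow_add, mul_right_comm, mul_comm _ 2]
    exact Nat.mul_le_mul_right _ (two_mul_pow_le_succ_pow hle)
  have hcover : (Finset.univ : Finset (Fin T → J → Fin b)) ⊆ Finset.univ.biUnion bad := by
    intro g _
    obtain ⟨x, y, hg⟩ := hbad g
    refine Finset.mem_biUnion.2 ⟨(x, y), Finset.mem_univ _, ?_⟩
    simp only [bad, Fintype.mem_piFinset]
    intro s j
    split_ifs with hj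
    · simpa using hg s j hj
    · simp
  have hle := (Finset.card_le_card hcover).trans Finset.card_biUnion_le
  have htotal : (b ^ Fintype.card J) ^ T * 2 ^ T ≤
      (b ^ Fintype.card J) ^ T * (Fintype.card X * b) := by
    calc (b ^ Fintype.card J) ^ T * 2 ^ T ≤ (∑ p, (bad p).card) * 2 ^ T := by
          gcongr
          simpa using hle
      _ = ∑ p, (bad p).card * 2 ^ T := Finset.sum_mul ..
      _ ≤ ∑ _p : X × Fin b, (b ^ Fintype.card J) ^ T := Finset.sum_le_sum fun p _ => hcard p
      _ = _ := by simp [mul_comm]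
  exact absurd (Nat.le_of_mul_le_mul_left htotal (by positivity)) (by lia)

theorem exists_sum_le_mul_card_mul_log {X : Type*} [Fintype X] (d : X → ℕ) {D : ℕ}
    (hd : ∀ x, d x ≤ D) (hpos : 0 < ∑ x, d x) :
    ∃ c, 0 < c ∧ ((∑ x, d x : ℕ) : ℝ) ≤
      c * (Finset.univ.filter fun x => c ≤ d x).card * (1 + Real.log D) := by
  by_contra! hcon
  have hD : 0 < D := by
    rw [Nat.pos_iff_ne_zero]
    rintro rfl
    simp [fun x => Nat.le_zero.1 (hd x)] at hpos
  have hL : 0 < 1 + Real.log D := by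
    have := Real.log_natCast_nonneg D
    positivity
  set M : ℝ := ((∑ x, d x : ℕ) : ℝ) with hM
  have hMpos : 0 < M := by
    rw [hM]
    exact_mod_cast hpos
  have hlayer : M = ∑ c ∈ Finset.Icc 1 D, ((Finset.univ.filter fun x => c ≤ d x).card : ℝ) := by
    rw [hM, ← Nat.cast_sum]
    congr 1
    simp only [Finset.card_filter]
    rw [Finset.sum_comm]
    refine Finset.sum_congr rfl fun x _ => ?_
    rw [← Finset.card_filter]
    have : (Finset.Icc 1 D).filter (fun c => c ≤ d x) = Finset.Icc 1 (d x) := by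
      ext c
      have := hd x
      simp only [Finset.mem_filter, Finset.mem_Icc]
      lia
    simp [this]
  have hlt : M < ∑ c ∈ Finset.Icc 1 D, M / (1 + Real.log D) * (c : ℝ)⁻¹ := by
    conv_lhs => rw [hlayer]
    refine Finset.sum_lt_sum_of_nonempty ⟨1, by simp; lia⟩ fun c hc => ?_
    have hc : 0 < c := (Finset.mem_Icc.1 hc).1
    have hc' : (0 : ℝ) < c := by exact_mod_cast hc
    rw [← div_eq_mul_inv, div_div, lt_div_iff₀ (by positivity)]
    calc _ = c * ((Finset.univ.filter fun x => c ≤ d x).card : ℝ) * (1 + Real.log D) := by ring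
      _ < M := hcon c hc
  have hharm := harmonic_le_one_add_log D
  rw [harmonic_eq_sum_Icc] at hharm
  push_cast at hharm
  rw [← Finset.mul_sum] at hlt
  have : M / (1 + Real.log D) * ∑ c ∈ Finset.Icc 1 D, (c : ℝ)⁻¹ ≤
      M / (1 + Real.log D) * (1 + Real.log D) := by gcongr
  rw [div_mul_cancel₀ _ hL.ne'] at this
  linarith

theorem ncard_triplePower {I J K : Type*} (Λ : Set (I × J × K)) (N : ℕ) :
    (triplePower Λ N).ncard = Λ.ncard ^ N := by
  let e : triplePower Λ N ≃ (Fin N → Λ) :=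
    { toFun := fun p n => ⟨_, p.2 n⟩
      invFun := fun p => ⟨(fun n => (p n).1.1, fun n => (p n).1.2.1, fun n => (p n).1.2.2),
        fun n => (p n).2⟩
      left_inv := fun _ => rfl
      right_inv := fun _ => rfl }
  rw [← Nat.card_coe_set_eq, ← Nat.card_coe_set_eq, Nat.card_congr e, Nat.card_fun]
  simp

theorem SupportRankLE.exists_box {F : Type*} [Field F] [Infinite F] {I J K : Type*} [Fintype I]
    [Fintype J] [Fintype K] {Λ : Set (I × J × K)} {r T : ℕ}
    (hr : SupportRankLE F (PMMSupport Λ) r) (hΛ : Λ.Nonempty)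
    (hT : Fintype.card I * Fintype.card J * Fintype.card K < 2 ^ T) :
    ∃ a b c : ℕ, SupportRankLE F (PMMSupport (Set.univ : Set (Fin a × Fin b × Fin c))) (T * T * r) ∧
      (Λ.ncard : ℝ) ≤ (a * b * c : ℕ) *
        ((1 + Real.log (Fintype.card J)) * (1 + Real.log (Fintype.card K))) := by
  classical
  obtain ⟨⟨i₀, j₀, k₀⟩, hmem⟩ := id hΛ
  have hI : 0 < Fintype.card I := Fintype.card_pos_iff.2 ⟨i₀⟩
  have hJ : 0 < Fintype.card J := Fintype.card_pos_iff.2 ⟨j₀⟩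
  have hK : 0 < Fintype.card K := Fintype.card_pos_iff.2 ⟨k₀⟩
  let N : I × J → Finset K := fun e => Finset.univ.filter fun k => (e.1, e.2, k) ∈ Λ
  have hsum : ∑ e, (N e).card = Λ.ncard := by
    rw [Set.ncard_eq_toFinset_card', ← Set.filter_mem_univ_eq_toFinset, Finset.card_filter,
      Fintype.sum_prod_type, Fintype.sum_prod_type]
    simp only [Fintype.sum_prod_type, N, Finset.card_filter]
  have hΛpos : 0 < Λ.ncard := (Set.ncard_pos).2 hΛ
  obtain ⟨c, hc, hΛc⟩ := exists_sum_le_mul_card_mul_log (fun e => (N e).card)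
    (fun e => Finset.card_le_univ _) (hsum ▸ hΛpos)
  rw [hsum] at hΛc
  set E := Finset.univ.filter fun e => c ≤ (N e).card with hE
  have hEpos : 0 < E.card := by
    rw [Nat.pos_iff_ne_zero]
    intro h0
    rw [h0] at hΛc
    have : (0 : ℝ) < Λ.ncard := by exact_mod_cast hΛpos
    simp only [Nat.cast_zero, mul_zero, zero_mul] at hΛc
    linarith
  let M : I → Finset J := fun i => Finset.univ.filter fun j => (i, j) ∈ E
  have hsumE : ∑ i, (M i).card = E.card := by
    rw [← Finset.filter_univ_mem E, Finset.card_filter, Fintype.sum_prod_type]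
    simp only [M, Finset.card_filter]
  obtain ⟨b, hb, hEb⟩ := exists_sum_le_mul_card_mul_log (fun i => (M i).card)
    (fun e => Finset.card_le_univ _) (hsumE ▸ hEpos)
  rw [hsumE] at hEb
  set A := Finset.univ.filter fun i => b ≤ (M i).card with hA
  have hApos : 0 < A.card := by
    rw [Nat.pos_iff_ne_zero]
    intro h0
    rw [h0] at hEb
    have : (0 : ℝ) < E.card := by exact_mod_cast hEpos
    simp only [Nat.cast_zero, mul_zero, zero_mul] at hEb
    linarith
  have hcK : c ≤ Fintype.card K := by
    obtain ⟨e, he⟩ := Finset.card_pos.1 hEpos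
    exact (Finset.mem_filter.1 he).2.trans (Finset.card_le_univ _)
  have hbJ : b ≤ Fintype.card J := by
    obtain ⟨e, he⟩ := Finset.card_pos.1 hApos
    exact (Finset.mem_filter.1 he).2.trans (Finset.card_le_univ _)
  obtain ⟨g, hg⟩ := exists_hash_family (T := T) (fun i : A => M i) hb
    (fun i => (Finset.mem_filter.1 i.2).2) <| by
      refine lt_of_le_of_lt ?_ hT
      rw [Fintype.card_coe]
      calc A.card * b ≤ Fintype.card I * Fintype.card J * 1 := by
            rw [mul_one]
            exact Nat.mul_le_mul (Finset.card_le_univ _) hbJ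
        _ ≤ _ := Nat.mul_le_mul_left _ hK
  obtain ⟨h, hh⟩ := exists_hash_family (T := T) (fun e : E => N e) hc
    (fun e => (Finset.mem_filter.1 e.2).2) <| by
      refine lt_of_le_of_lt ?_ hT
      rw [Fintype.card_coe, ← Fintype.card_prod I J]
      exact Nat.mul_le_mul (Finset.card_le_univ _) hcK
  have : Nonempty (Fin A.card) := ⟨⟨0, hApos⟩⟩
  let ι : Fin A.card → I := fun p => (A.equivFin.symm p : I)
  have hι : ι.Injective := Subtype.val_injective.comp A.equivFin.symm.injective
  refine ⟨A.card, b, c, ?_, ?_⟩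
  · have := hr.of_cover (σ := Fin T × Fin T) (fun _ => Function.invFun ι) (fun x => g x.1)
      (fun x => h x.2) fun p q s => by
        obtain ⟨x, j, hj, hgj⟩ := hg (A.equivFin.symm p) q
        have hij : (ι p, j) ∈ E := (Finset.mem_filter.1 hj).2
        obtain ⟨y, k, hk, hhk⟩ := hh ⟨_, hij⟩ s
        exact ⟨(x, y), ι p, j, k, (Finset.mem_filter.1 hk).2,
          Function.leftInverse_invFun hι p, hgj, hhk⟩
    simpa using this
  · have hLK : 0 ≤ 1 + Real.log (Fintype.card K) := by
      have := Real.log_natCast_nonneg (Fintype.card K)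
      positivity
    calc (Λ.ncard : ℝ) ≤ c * E.card * (1 + Real.log (Fintype.card K)) := hΛc
      _ ≤ c * (b * A.card * (1 + Real.log (Fintype.card J))) *
          (1 + Real.log (Fintype.card K)) := by gcongr
      _ = _ := by push_cast; ring

end Combinatorics

section Asymptotics

variable {F : Type*} [Field F] [Infinite F]

theorem SupportRankLE.cube {a b c r : ℕ}
    (h : SupportRankLE F (PMMSupport (Set.univ : Set (Fin a × Fin b × Fin c))) r) :
    SupportRankLE F (PMMSupport
      (Set.univ : Set (Fin (a * b * c) × Fin (a * b * c) × Fin (a * b * c)))) (r ^ 3) := by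
  have h₂ := (h.prod h.rotate).prod h.rotate.rotate
  simp only [Set.mem_univ, and_self, Set.ofPred_true] at h₂
  have e₁ : (Fin a × Fin b) × Fin c ≃ Fin (a * b * c) := Fintype.equivOfCardEq (by simp)
  have e₂ : (Fin b × Fin c) × Fin a ≃ Fin (a * b * c) :=
    Fintype.equivOfCardEq (by simp; ring)
  have e₃ : (Fin c × Fin a) × Fin b ≃ Fin (a * b * c) :=
    Fintype.equivOfCardEq (by simp; ring)
  rw [pow_three']
  exact h₂.of_surjective e₁.surjective e₂.surjective e₃.surjective

theorem supportRank_MMSupport_le_pow {V r W m : ℕ}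
    (h : SupportRankLE F (PMMSupport (Set.univ : Set (Fin V × Fin V × Fin V))) r)
    (hW : 0 < W) (hWV : W ≤ V ^ m) : SupportRank F (MMSupport W W W) ≤ r ^ m := by
  have hpow := h.pow m
  have huniv : triplePower (Set.univ : Set (Fin V × Fin V × Fin V)) m = Set.univ := by
    ext
    simp [triplePower]
  rw [huniv] at hpow
  obtain ⟨f⟩ : Nonempty (Fin W ↪ (Fin m → Fin V)) :=
    Function.Embedding.nonempty_of_card_le (by simpa using hWV)
  have : Nonempty (Fin W) := ⟨⟨0, hW⟩⟩
  have hf := Function.invFun_surjective f.injective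
  have hle := (hpow.of_surjective hf hf hf).supportRank_le
  have hMM : MMSupport W W W = PMMSupport (Set.univ : Set (Fin W × Fin W × Fin W)) := by
    ext
    simp [MMSupport, PMMSupport]
  rwa [hMM]

theorem logb_two_natCast_nonneg (n : ℕ) : 0 ≤ Real.logb 2 n :=
  div_nonneg (Real.log_natCast_nonneg n) (Real.log_nonneg one_le_two)

theorem omegaS_mul_logb_le {V r : ℕ}
    (h : SupportRankLE F (PMMSupport (Set.univ : Set (Fin V × Fin V × Fin V))) r) :
    omegaS F 1 1 1 * Real.logb 2 V ≤ Real.logb 2 r := by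
  rcases Nat.lt_or_ge V 2 with hV | hV
  · have : Real.logb 2 V = 0 := by interval_cases V <;> simp
    rw [this, mul_zero]
    exact logb_two_natCast_nonneg r
  have hV' : (1 : ℝ) < V := by exact_mod_cast hV
  have hlogV : 0 < Real.logb 2 V := Real.logb_pos one_lt_two hV'
  have hr : 0 < r := h.pos ⟨_, ⟨0, by lia⟩, ⟨0, by lia⟩, ⟨0, by lia⟩, trivial, rfl⟩
  have hlogr := logb_two_natCast_nonneg r
  rw [← le_div_iff₀ hlogV]
  have hbound : ∀ n : ℕ, 0 < n → (1 / n : ℝ) * Real.logb 2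
      (SupportRank F (MMSupport ⌊(2 : ℝ) ^ ((1 : ℝ) * n)⌋₊ ⌊(2 : ℝ) ^ ((1 : ℝ) * n)⌋₊
        ⌊(2 : ℝ) ^ ((1 : ℝ) * n)⌋₊)) ≤
      Real.logb 2 r / Real.logb 2 V + Real.logb 2 r / n := by
    intro n hn
    have hn' : (0 : ℝ) < n := by exact_mod_cast hn
    have hfloor : ⌊(2 : ℝ) ^ ((1 : ℝ) * n)⌋₊ = 2 ^ n := by
      rw [one_mul, Real.rpow_natCast]
      exact_mod_cast Nat.floor_natCast (2 ^ n)
    rw [hfloor]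
    set m := ⌈n / Real.logb 2 V⌉₊ with hm
    have hle : 2 ^ n ≤ V ^ m := by
      have h₁ : (n : ℝ) ≤ m * Real.logb 2 V := (div_le_iff₀ hlogV).1 (Nat.le_ceil _)
      have h₂ : ((2 : ℝ)) ^ n ≤ (V : ℝ) ^ m := by
        rw [← Real.logb_le_logb one_lt_two (by positivity) (by positivity), Real.logb_pow,
          Real.logb_pow, Real.logb_self_eq_one one_lt_two, mul_one]
        exact h₁
      exact_mod_cast h₂
    have hrank := supportRank_MMSupport_le_pow h (by positivity) hle
    have hlog : Real.logb 2 (SupportRank F (MMSupport (2 ^ n) (2 ^ n) (2 ^ n))) ≤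
        m * Real.logb 2 r := by
      rw [← Real.logb_pow]
      rcases Nat.eq_zero_or_pos (SupportRank F (MMSupport (2 ^ n) (2 ^ n) (2 ^ n))) with h0 | h0
      · rw [h0, Nat.cast_zero, Real.logb_zero]
        exact_mod_cast logb_two_natCast_nonneg (r ^ m)
      · exact Real.logb_le_logb_of_le one_lt_two (by exact_mod_cast h0) (by exact_mod_cast hrank)
    have hmle : (m : ℝ) ≤ n / Real.logb 2 V + 1 := (Nat.ceil_lt_add_one (by positivity)).le
    calc _ ≤ (1 / n : ℝ) * ((n / Real.logb 2 V + 1) * Real.logb 2 r) := by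
          gcongr
          exact hlog.trans (by gcongr)
      _ = _ := by field_simp
  have hlim : Filter.Tendsto (fun n : ℕ => Real.logb 2 r / Real.logb 2 V + Real.logb 2 r / n)
      Filter.atTop (nhds (Real.logb 2 r / Real.logb 2 V)) := by
    simpa using (tendsto_const_div_atTop_nhds_zero_nat (Real.logb 2 r)).const_add
      (Real.logb 2 r / Real.logb 2 V)
  rw [← hlim.limsup_eq]
  refine Filter.limsup_le_limsup ?_ ?_ hlim.isBoundedUnder_le
  · filter_upwards [Filter.eventually_gt_atTop 0] with n hn using hbound n hn
  · exact Filter.isCoboundedUnder_le_of_le _ (x := 0) fun n =>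
      mul_nonneg (by positivity) (logb_two_natCast_nonneg _)

theorem tendsto_logb_two_natCast_div_atTop :
    Filter.Tendsto (fun N : ℕ => Real.logb 2 N / N) Filter.atTop (nhds 0) := by
  have h := (Real.isLittleO_log_id_atTop.tendsto_div_nhds_zero.comp
    tendsto_natCast_atTop_atTop).div_const (Real.log 2)
  rw [zero_div] at h
  exact h.congr fun N => div_right_comm _ _ _

theorem one_add_log_pow_le {n N : ℕ} (hN : 0 < N) :
    1 + Real.log ((n ^ N : ℕ) : ℝ) ≤ N * (1 + Real.log n) := by
  have hN' : (1 : ℝ) ≤ N := by exact_mod_cast hN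
  rw [Nat.cast_pow, Real.log_pow]
  linarith

/-- The finite form of the main estimate: both sides differ from their `N`-fold leading terms only
by a logarithm of `N`. -/
theorem omegaS_mul_le_of_nonneg {I J K : Type*} [Fintype I] [Fintype J] [Fintype K]
    {Λ : Set (I × J × K)} (hΛ : Λ.Nonempty) (hω : 0 ≤ omegaS F 1 1 1) {T : ℕ}
    (hT : Fintype.card I * Fintype.card J * Fintype.card K < 2 ^ T) {N : ℕ} (hN : 0 < N) :
    omegaS F 1 1 1 * (N * Real.logb 2 Λ.ncard - (2 * Real.logb 2 N + Real.logb 2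
        ((1 + Real.log (Fintype.card J)) * (1 + Real.log (Fintype.card K))))) ≤
      3 * (N * Real.logb 2 (SupportRank F (PMMSupport Λ)) +
        (2 * Real.logb 2 N + 2 * Real.logb 2 T)) := by
  have hR := supportRankLE_supportRank (F := F) (PMMSupport Λ)
  obtain ⟨⟨i₀, j₀, k₀⟩, hmem⟩ := id hΛ
  have hRpos : 0 < SupportRank F (PMMSupport Λ) := hR.pos ⟨_, i₀, j₀, k₀, hmem, rfl⟩
  have hI : 0 < Fintype.card I := Fintype.card_pos_iff.2 ⟨i₀⟩
  have hJ : 0 < Fintype.card J := Fintype.card_pos_iff.2 ⟨j₀⟩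
  have hK : 0 < Fintype.card K := Fintype.card_pos_iff.2 ⟨k₀⟩
  have hTpos : 0 < T := by
    rw [Nat.pos_iff_ne_zero]
    rintro rfl
    have : 0 < Fintype.card I * Fintype.card J * Fintype.card K := by positivity
    rw [pow_zero] at hT
    lia
  have hΛpos : 0 < Λ.ncard := (Set.ncard_pos).2 hΛ
  obtain ⟨a, b, c, hbox, hcard⟩ := (hR.pow N).exists_box (T := T * N)
    ⟨(fun _ => i₀, fun _ => j₀, fun _ => k₀), fun _ => hmem⟩ <| by
      simp only [Fintype.card_fun, Fintype.card_fin, ← mul_pow, pow_mul]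
      exact Nat.pow_lt_pow_left hT hN.ne'
  have hω_le := omegaS_mul_logb_le hbox.cube
  rw [ncard_triplePower] at hcard
  simp only [Fintype.card_fun, Fintype.card_fin] at hcard
  set V := a * b * c
  set R := SupportRank F (PMMSupport Λ)
  set x := Real.log (Fintype.card J)
  set y := Real.log (Fintype.card K)
  have hx : 0 ≤ x := Real.log_natCast_nonneg _
  have hy : 0 ≤ y := Real.log_natCast_nonneg _
  have hN' : (0 : ℝ) < N := by exact_mod_cast hN
  have hΛ' : (0 : ℝ) < Λ.ncard := by exact_mod_cast hΛpos
  have hcard' : (Λ.ncard : ℝ) ^ N ≤ V * ((N * (1 + x)) * (N * (1 + y))) := by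
    simp only [Nat.cast_pow] at hcard
    refine hcard.trans ?_
    have h₁ := one_add_log_pow_le (n := Fintype.card J) hN
    have h₂ := one_add_log_pow_le (n := Fintype.card K) hN
    have h₃ := Real.log_natCast_nonneg (Fintype.card K ^ N)
    push_cast at h₁ h₂ h₃
    gcongr
  have hVpos : (0 : ℝ) < V := by
    have := (pow_pos hΛ' N).trans_le hcard'
    exact pos_of_mul_pos_left this (by positivity)
  have hlogΛ : N * Real.logb 2 Λ.ncard ≤
      Real.logb 2 V + (2 * Real.logb 2 N + Real.logb 2 ((1 + x) * (1 + y))) := by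
    rw [← Real.logb_pow]
    refine (Real.logb_le_logb_of_le one_lt_two (by positivity) hcard').trans_eq ?_
    rw [mul_mul_mul_comm, Real.logb_mul hVpos.ne' (by positivity),
      Real.logb_mul (by positivity) (by positivity), Real.logb_mul hN'.ne' hN'.ne']
    ring
  have hlogR : Real.logb 2 (((T * N * (T * N) * R ^ N) ^ 3 : ℕ) : ℝ) =
      3 * (N * Real.logb 2 R + (2 * Real.logb 2 N + 2 * Real.logb 2 T)) := by
    have hT' : (T : ℝ) ≠ 0 := by exact_mod_cast hTpos.ne'
    have hR' : (R : ℝ) ≠ 0 := by exact_mod_cast hRpos.ne'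
    push_cast
    rw [Real.logb_pow, Real.logb_mul (by positivity) (by positivity),
      Real.logb_mul (by positivity) (by positivity), Real.logb_mul hT' hN'.ne', Real.logb_pow]
    push_cast
    ring
  rw [← hlogR]
  refine le_trans (mul_le_mul_of_nonneg_left ?_ hω) hω_le
  linarith

end Asymptotics

theorem omegaS_le_three_log_supportRank_div_log_card
    (F : Type*) [Field F] [Infinite F]
    {I J K : Type*} [Fintype I] [Fintype J] [Fintype K]
    (Λ : Set (I × J × K)) (hΛ : 2 ≤ Λ.ncard) :
    omegaS F 1 1 1 ≤
      3 * Real.logb 2 (SupportRank F (PMMSupport Λ)) / Real.logb 2 (Λ.ncard) := by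
  have hne : Λ.Nonempty := Set.nonempty_of_ncard_ne_zero (by lia)
  have hlogΛ : 0 < Real.logb 2 Λ.ncard := Real.logb_pos one_lt_two (by exact_mod_cast hΛ)
  rcases lt_or_ge (omegaS F 1 1 1) 0 with hω | hω
  · have := logb_two_natCast_nonneg (SupportRank F (PMMSupport Λ))
    exact hω.le.trans (by positivity)
  rw [le_div_iff₀ hlogΛ]
  obtain ⟨T, hT⟩ : ∃ T, Fintype.card I * Fintype.card J * Fintype.card K < 2 ^ T :=
    ⟨_, Nat.lt_two_pow_self⟩
  have herr (D : ℝ) :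
      Filter.Tendsto (fun N : ℕ => (2 * Real.logb 2 N + D) / N) Filter.atTop (nhds 0) := by
    have h := (tendsto_logb_two_natCast_div_atTop.const_mul 2).add
      (tendsto_const_div_atTop_nhds_zero_nat D)
    rw [mul_zero, add_zero] at h
    exact h.congr fun N => by ring
  have hleft := ((herr (Real.logb 2 ((1 + Real.log (Fintype.card J)) *
    (1 + Real.log (Fintype.card K))))).const_sub (Real.logb 2 Λ.ncard)).const_mul (omegaS F 1 1 1)
  have hright := ((herr (2 * Real.logb 2 T)).const_add
    (Real.logb 2 (SupportRank F (PMMSupport Λ)))).const_mul 3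
  rw [sub_zero] at hleft
  rw [add_zero] at hright
  refine le_of_tendsto_of_tendsto hleft hright ?_
  filter_upwards [Filter.eventually_gt_atTop 0] with N hN
  have hN' : (0 : ℝ) < N := by exact_mod_cast hN
  refine le_of_mul_le_mul_left ?_ hN'
  simpa only [mul_left_comm (N : ℝ), mul_sub (N : ℝ), mul_add (N : ℝ), mul_div_cancel₀ _ hN'.ne']
    using omegaS_mul_le_of_nonneg hne hω hT hN
end
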